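/- arXiv:0706.1540 — 4 statements merged into one kernel-verified Lean document; each statement's English description precedes it below -/
import Mathlib

section
/- Let n and k be positive integers with k < n/3 + 1. Then for every complex n×n matrix A, the rank-k numerical range Λ_k(A) is non-empty; that is, there exist a complex number λ and an n×k matrix X with X*X = I_k and X*AX = λ I_k. -/
open Matrix

namespace RankK
open Polynomial

lemma prod_sign (r : ℕ) (y : Fin (2 * r + 1) → ℝ) (hy : StrictMono y) (q : Fin (2 * r + 1)) :
    0 < (-1 : ℝ) ^ (q : ℕ) * ∏ j ∈ Finset.univ.erase q, (y q - y j) := by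
  have h1 : (Finset.univ.erase q : Finset (Fin (2 * r + 1))) =
      (Finset.Iio q).disjUnion (Finset.Ioi q) (by
        rw [Finset.disjoint_left]; intro j hj hj'
        simp at hj hj'; exact absurd hj (not_lt.mpr hj'.le)) := by
    ext j; simp [lt_or_lt_iff_ne]
  rw [h1, Finset.prod_disjUnion]
  have h2 : ∏ j ∈ Finset.Ioi q, (y q - y j) =
      (-1 : ℝ) ^ (2 * r - q : ℕ) * ∏ j ∈ Finset.Ioi q, (y j - y q) := by
    have : ∏ j ∈ Finset.Ioi q, (y q - y j) = ∏ j ∈ Finset.Ioi q, ((-1) * (y j - y q)) :=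
      Finset.prod_congr rfl (fun j _ => by ring)
    rw [this, Finset.prod_mul_distrib, Finset.prod_const, Fin.card_Ioi]
    congr 2
  have h3 : 0 < ∏ j ∈ Finset.Iio q, (y q - y j) :=
    Finset.prod_pos (fun j hj => sub_pos.mpr (hy (Finset.mem_Iio.mp hj)))
  have h4 : 0 < ∏ j ∈ Finset.Ioi q, (y j - y q) :=
    Finset.prod_pos (fun j hj => sub_pos.mpr (hy (Finset.mem_Ioi.mp hj)))
  have h5 : (-1 : ℝ) ^ (q : ℕ) * (-1 : ℝ) ^ (2 * r - q : ℕ) = 1 := by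
    rw [← pow_add, Nat.add_sub_cancel' (by omega), pow_mul]; simp
  rw [h2]
  calc (0:ℝ) < (∏ j ∈ Finset.Iio q, (y q - y j)) * ∏ j ∈ Finset.Ioi q, (y j - y q) :=
        mul_pos h3 h4
    _ = ((-1 : ℝ) ^ (q : ℕ) * (-1 : ℝ) ^ (2 * r - q : ℕ)) *
        ((∏ j ∈ Finset.Iio q, (y q - y j)) * ∏ j ∈ Finset.Ioi q, (y j - y q)) := by
        rw [h5, one_mul]
    _ = _ := by ring

variable {V : Type*} [AddCommGroup V] [Module ℂ V]

lemma conj_eval (P : ℂ[X]) (x : ℝ) :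
    (starRingEnd ℂ) (P.eval (x : ℂ)) = (P.map (starRingEnd ℂ)).eval (x : ℂ) := by
  have := Polynomial.hom_eval₂ P (RingHom.id ℂ) (starRingEnd ℂ) (x : ℂ)
  simp only [Complex.conj_ofReal, RingHomCompTriple.comp_eq] at this
  rw [Polynomial.eval_map, ← this, Polynomial.eval]

lemma chain_isotropic (a : V →ₗ⋆[ℂ] V →ₗ[ℂ] ℂ) (r : ℕ) (g : Fin (2 * r + 1) → V)
    (hg : LinearIndependent ℂ g) (hort : ∀ i j, i ≠ j → a (g i) (g j) = 0)
    (σ y : Fin (2 * r + 1) → ℝ) (hy : StrictMono y)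
    (hσ : ∀ q : Fin (2 * r + 1), 0 < (-1 : ℝ) ^ ((q : ℕ) + 1) * σ q)
    (hd : ∀ q, a (g q) (g q) = σ q * (1 + Complex.I * y q)) :
    ∃ U : Submodule ℂ V, U ≤ Submodule.span ℂ (Set.range g) ∧ Module.finrank ℂ U = r ∧
      ∀ x ∈ U, ∀ z ∈ U, a x z = 0 := by
  set D : Fin (2 * r + 1) → ℝ := fun q => ∏ j ∈ Finset.univ.erase q, (y q - y j) with hD
  have hsD : ∀ q, σ q * D q < 0 := by
    intro q
    have h1 := mul_pos (hσ q) (prod_sign r y hy q)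
    have h2 : (-1 : ℝ) ^ ((q : ℕ) + 1) * σ q * ((-1 : ℝ) ^ (q : ℕ) *
      ∏ j ∈ Finset.univ.erase q, (y q - y j)) = - (((-1 : ℝ) ^ (q : ℕ)) ^ 2 * (σ q * D q)) := by
      simp only [hD]; ring
    rw [h2, ← pow_mul, mul_comm (q : ℕ) 2, pow_mul] at h1
    simp at h1
    exact h1
  set c : Fin (2 * r + 1) → ℝ := fun q => 1 / Real.sqrt (-(σ q * D q)) with hc
  have hc0 : ∀ q, c q ≠ 0 := by
    intro q
    have := Real.sqrt_pos.mpr (neg_pos.mpr (hsD q))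
    simp only [hc]; positivity
  have hc2 : ∀ q, c q * c q * σ q = - (1 / D q) := by
    intro q
    have h1 := hsD q
    have h2 : c q * c q = 1 / (-(σ q * D q)) := by
      simp only [hc]
      rw [div_mul_div_comm, Real.mul_self_sqrt (by linarith)]; simp
    have hs : σ q ≠ 0 := by rintro h; rw [h] at h1; simp at h1
    have hDq : D q ≠ 0 := by rintro h; rw [h] at h1; simp at h1
    rw [h2]; field_simp
  let T : ℂ[X] →ₗ[ℂ] V :=
    ∑ q, ((c q : ℂ) • (Polynomial.leval (y q : ℂ))).smulRight (g q)
  have hT : ∀ P, T P = ∑ q, ((c q : ℂ) * P.eval (y q : ℂ)) • g q := by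
    intro P; simp [T, LinearMap.sum_apply, Polynomial.leval_apply]
  have hyinj : Function.Injective (fun q => (y q : ℂ)) :=
    Complex.ofReal_injective.comp hy.injective
  refine ⟨(degreeLT ℂ r).map T, ?_, ?_, ?_⟩
  · rintro _ ⟨P, -, rfl⟩
    rw [hT]
    exact Submodule.sum_mem _ (fun q _ => Submodule.smul_mem _ _ (Submodule.subset_span ⟨q, rfl⟩))
  · have hinj : Function.Injective (T.comp (degreeLT ℂ r).subtype) := by
      rw [← LinearMap.ker_eq_bot, LinearMap.ker_eq_bot']
      rintro ⟨P, hP⟩ h0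
      simp only [LinearMap.comp_apply, Submodule.subtype_apply] at h0
      rw [hT] at h0
      have h1 := Fintype.linearIndependent_iff.mp hg _ h0
      have h2 : ∀ q, P.eval (y q : ℂ) = 0 := by
        intro q
        have := h1 q
        simpa [hc0 q] using this
      have : P = 0 := by
        refine Polynomial.eq_zero_of_degree_lt_of_eval_index_eq_zero (s := Finset.univ)
          (v := fun q => (y q : ℂ)) (hyinj.injOn) ?_ (fun q _ => h2 q)
        rw [Polynomial.mem_degreeLT] at hP
        refine hP.trans_le ?_
        simp only [Finset.card_univ, Fintype.card_fin]
        exact_mod_cast (by omega : r ≤ 2 * r + 1)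
      simpa using this
    have h1 := LinearMap.finrank_range_of_inj hinj
    rw [LinearMap.range_comp, Submodule.range_subtype] at h1
    rw [h1, LinearEquiv.finrank_eq (degreeLTEquiv ℂ r)]; simp
  · rintro _ ⟨P, hP, rfl⟩ _ ⟨Q, hQ, rfl⟩
    have hP' : P.degree < r := Polynomial.mem_degreeLT.mp hP
    have hQ' : Q.degree < r := Polynomial.mem_degreeLT.mp hQ
    rw [hT, hT]
    simp only [map_sum, LinearMap.sum_apply, map_smulₛₗ, LinearMap.smul_apply, smul_eq_mul,
      RingHom.id_apply]
    have h1 : ∀ q, ∑ q', ((c q' : ℂ) * Q.eval (y q' : ℂ)) *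
        ((starRingEnd ℂ) ((c q : ℂ) * P.eval (y q : ℂ)) * a (g q) (g q')) =
        - (((P.map (starRingEnd ℂ)) * Q * (1 + C Complex.I * X)).eval (y q : ℂ) /
          ∏ j ∈ Finset.univ.erase q, ((y q : ℂ) - y j)) := by
      intro q
      rw [Finset.sum_eq_single q]
      · rw [hd q, map_mul, conj_eval]
        have h3 : ((c q : ℂ) * c q * σ q) = - (1 / ∏ j ∈ Finset.univ.erase q, ((y q : ℂ) - y j)) := by
          have := congrArg (fun t : ℝ => (t : ℂ)) (hc2 q)
          simp only [hD] at this
          push_cast at this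
          exact this
        simp only [Complex.conj_ofReal, eval_mul, eval_add, eval_one, eval_C, eval_X]
        calc _ = ((c q : ℂ) * c q * σ q) * ((P.map (starRingEnd ℂ)).eval (y q : ℂ) *
            Q.eval (y q : ℂ) * (1 + Complex.I * y q)) := by ring
          _ = _ := by rw [h3]; ring
      · intro q' _ hne; rw [hort q q' hne.symm]; simp
      · simp
    simp only [Finset.mul_sum]
    rw [Finset.sum_comm, Finset.sum_congr rfl (fun q _ => h1 q)]
    rw [Finset.sum_neg_distrib, neg_eq_zero]
    set F := (P.map (starRingEnd ℂ)) * Q * (1 + C Complex.I * X) with hF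
    by_cases hP0 : P = 0
    · simp [hF, hP0]
    by_cases hQ0 : Q = 0
    · simp [hF, hQ0]
    have hPn : P.natDegree < r := (Polynomial.natDegree_lt_iff_degree_lt hP0).mpr hP'
    have hQn : Q.natDegree < r := (Polynomial.natDegree_lt_iff_degree_lt hQ0).mpr hQ'
    have hFn : F.natDegree < 2 * r := by
      have h3 : F.natDegree ≤ (P.map (starRingEnd ℂ) * Q).natDegree +
        (1 + C Complex.I * X : ℂ[X]).natDegree := Polynomial.natDegree_mul_le
      have h4 : (P.map (starRingEnd ℂ) * Q).natDegree ≤ _ := Polynomial.natDegree_mul_le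
      have h5 := Polynomial.natDegree_map_le (p := P) (f := starRingEnd ℂ)
      have h6 : (1 + C Complex.I * X : ℂ[X]).natDegree ≤ 1 := by compute_degree
      omega
    have hco := Lagrange.coeff_eq_sum (s := Finset.univ) (v := fun q => (y q : ℂ)) hyinj.injOn
      (P := F) (by
        refine lt_of_le_of_lt Polynomial.degree_le_natDegree ?_
        simp only [Finset.card_univ, Fintype.card_fin]
        exact_mod_cast (by omega : F.natDegree < 2 * r + 1))
    rw [← hco]
    apply Polynomial.coeff_eq_zero_of_natDegree_lt
    simpa using hFn


/-- The node of a chain. -/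
def chainNode (b M c r : ℕ) (hr : ∀ p, p < r → c + p * M < b) (hc : c < M)
    (q : Fin (2 * r + 1)) : Fin (b + M) ⊕ Fin b :=
  if h : (q : ℕ) % 2 = 0 then
    Sum.inl ⟨c + (q / 2 : ℕ) * M, by
      rcases Nat.eq_zero_or_pos (q / 2 : ℕ) with h0 | h0
      · rw [h0]; omega
      · have h1 := hr (q / 2 - 1 : ℕ) (by omega)
        have h2 : (q / 2 : ℕ) = (q / 2 - 1 : ℕ) + 1 := by omega
        rw [h2, add_mul]; omega⟩
  else Sum.inr ⟨c + (q / 2 : ℕ) * M, hr _ (by omega)⟩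

def cls (b M : ℕ) : Fin (b + M) ⊕ Fin b → ℕ := Sum.elim (fun i => i % M) (fun i => i % M)

lemma cls_chainNode (b M c r : ℕ) (hr : ∀ p, p < r → c + p * M < b) (hc : c < M)
    (q : Fin (2 * r + 1)) : cls b M (chainNode b M c r hr hc q) = c := by
  unfold chainNode cls
  split_ifs <;> simp [Nat.mod_eq_of_lt hc]

lemma interlace_isotropic (a : V →ₗ⋆[ℂ] V →ₗ[ℂ] ℂ) (b M : ℕ) (e : Fin (b + M) ⊕ Fin b → V)
    (he : LinearIndependent ℂ e) (hort : ∀ i j, i ≠ j → a (e i) (e j) = 0)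
    (σ x : Fin (b + M) ⊕ Fin b → ℝ)
    (hd : ∀ q, a (e q) (e q) = σ q * (1 + Complex.I * x q))
    (hσl : ∀ i, σ (Sum.inl i) < 0) (hσr : ∀ i, 0 < σ (Sum.inr i))
    (h1 : ∀ (i : ℕ) (hi : i < b), x (Sum.inl ⟨i, by omega⟩) < x (Sum.inr ⟨i, hi⟩))
    (h2 : ∀ (i : ℕ) (hi : i < b), x (Sum.inr ⟨i, hi⟩) < x (Sum.inl ⟨i + M, by omega⟩)) :
    ∃ U : Submodule ℂ V, U ≤ Submodule.span ℂ (Set.range e) ∧ b ≤ Module.finrank ℂ U ∧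
      ∀ x ∈ U, ∀ z ∈ U, a x z = 0 := by
  rcases Nat.eq_zero_or_pos M with rfl | hM
  · rcases Nat.eq_zero_or_pos b with rfl | hb
    · exact ⟨⊥, by simp, by simp, by simp⟩
    · exact absurd (h1 0 hb) (not_lt.mpr (h2 0 hb).le)
  have hex : ∀ c : ℕ, ∃ p, b ≤ c + p * M := fun c => ⟨b, by nlinarith⟩
  set r : ℕ → ℕ := fun c => Nat.find (hex c) with hrdef
  have hr : ∀ c p, p < r c → c + p * M < b := fun c p hp => not_le.mp (Nat.find_min (hex c) hp)
  have hr' : ∀ c p, c + p * M < b → p < r c := by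
    intro c p hp
    by_contra hcon
    have h3 : b ≤ c + r c * M := Nat.find_spec (hex c)
    have : r c * M ≤ p * M := Nat.mul_le_mul_right _ (not_lt.mp hcon)
    omega
  have hsum : b ≤ ∑ c ∈ Finset.range M, r c := by
    have : ∑ c ∈ Finset.range M, r c = ((Finset.range M).sigma (fun c => Finset.range (r c))).card := by
      simp [Finset.card_sigma]
    rw [this]
    calc b = (Finset.range b).card := by simp
      _ ≤ _ := by
        apply Finset.card_le_card_of_injOn (fun i => (⟨i % M, i / M⟩ : Σ _ : ℕ, ℕ))
        · intro i hi
          simp only [Finset.coe_range, Set.mem_Iio] at hi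
          simp only [Finset.coe_sigma, Set.mem_sigma_iff, Finset.coe_range, Set.mem_Iio]
          refine ⟨Nat.mod_lt _ hM, hr' _ _ ?_⟩
          rw [mul_comm, Nat.mod_add_div]; exact hi
        · intro i _ j _ hij
          simp only [Sigma.mk.injEq, heq_eq_eq] at hij
          rw [← Nat.mod_add_div i M, ← Nat.mod_add_div j M, hij.1, hij.2]
  have hchain : ∀ c, c < M → ∃ U : Submodule ℂ V,
      U ≤ Submodule.span ℂ (e '' {k | cls b M k = c}) ∧ Module.finrank ℂ U = r c ∧
      ∀ x ∈ U, ∀ z ∈ U, a x z = 0 := by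
    intro c hc
    set N := chainNode b M c (r c) (hr c) hc with hN
    have hmono : StrictMono (x ∘ N) := by
      rw [Fin.strictMono_iff_lt_succ]
      intro i
      simp only [Function.comp, hN, chainNode]
      rcases Nat.even_or_odd' (i : ℕ) with ⟨p, hp | hp⟩
      · have e1 : (i.castSucc : ℕ) = 2 * p := by simpa using hp
        have e2 : (i.succ : ℕ) = 2 * p + 1 := by simp [hp]
        have e3 : (2 * p + 1) % 2 ≠ 0 := by omega
        have e4 : (2 * p) % 2 = 0 := by omega
        simp only [e1, e2, e3, e4, dite_true, dite_false]
        have e5 : 2 * p / 2 = p := by omega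
        have e6 : (2 * p + 1) / 2 = p := by omega
        simp only [e5, e6]
        exact h1 _ (hr c p (by have := i.2; omega))
      · have e1 : (i.castSucc : ℕ) = 2 * p + 1 := by simpa using hp
        have e2 : (i.succ : ℕ) = 2 * p + 2 := by simp [hp]
        have e3 : (2 * p + 1) % 2 ≠ 0 := by omega
        have e4 : (2 * p + 2) % 2 = 0 := by omega
        simp only [e1, e2, e3, e4, dite_true, dite_false]
        have e5 : (2 * p + 2) / 2 = p + 1 := by omega
        have e6 : (2 * p + 1) / 2 = p := by omega
        simp only [e5, e6]
        have := h2 _ (hr c p (by have := i.2; omega))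
        have e7 : c + (p + 1) * M = c + p * M + M := by ring
        simp only [e7]
        exact this
    have hNinj : Function.Injective N := hmono.injective.of_comp
    obtain ⟨U, hU1, hU2, hU3⟩ := chain_isotropic a (r c) (e ∘ N) (he.comp _ hNinj)
      (fun i j hij => hort _ _ (fun h => hij (hNinj h))) (σ ∘ N) (x ∘ N) hmono (by
        intro q
        simp only [Function.comp, hN, chainNode]
        rcases Nat.even_or_odd (q : ℕ) with h | h
        · have e4 : (q : ℕ) % 2 = 0 := Nat.even_iff.mp h
          simp only [e4, dite_true]
          rw [pow_succ, h.neg_one_pow]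
          have := hσl ⟨c + (q / 2 : ℕ) * M, by
            rcases Nat.eq_zero_or_pos (q / 2 : ℕ) with h0 | h0
            · rw [h0]; omega
            · have h1 := hr c (q / 2 - 1 : ℕ) (by omega)
              have h2 : (q / 2 : ℕ) = (q / 2 - 1 : ℕ) + 1 := by omega
              rw [h2, add_mul]; omega⟩
          linarith
        · have e4 : (q : ℕ) % 2 ≠ 0 := by rw [Nat.odd_iff.mp h]; simp
          simp only [e4, dite_false]
          rw [pow_succ, h.neg_one_pow]
          have := hσr ⟨c + (q / 2 : ℕ) * M, hr c _ (by have := q.2; omega)⟩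
          linarith) (fun q => hd _)
    refine ⟨U, hU1.trans (Submodule.span_mono ?_), hU2, hU3⟩
    rintro _ ⟨q, rfl⟩
    exact ⟨N q, cls_chainNode _ _ _ _ _ _ _, rfl⟩
  have hspanort : ∀ (S T : Set (Fin (b + M) ⊕ Fin b)), Disjoint S T →
      ∀ x ∈ Submodule.span ℂ (e '' S), ∀ z ∈ Submodule.span ℂ (e '' T), a x z = 0 := by
    intro S T hST x hx z hz
    induction hx using Submodule.span_induction with
    | mem x hx =>
      obtain ⟨i, hi, rfl⟩ := hx
      induction hz using Submodule.span_induction with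
      | mem z hz =>
        obtain ⟨j, hj, rfl⟩ := hz
        exact hort i j (fun h => Set.disjoint_left.mp hST hi (h ▸ hj))
      | zero => simp
      | add z w _ _ hz hw => simp [hz, hw]
      | smul t z _ hz => simp [hz]
    | zero => simp
    | add x w _ _ hx hw => simp [hx, hw]
    | smul t x _ hx => simp [hx]
  have key : ∀ C, C ≤ M → ∃ U : Submodule ℂ V,
      U ≤ Submodule.span ℂ (e '' {k | cls b M k < C}) ∧
      ∑ c ∈ Finset.range C, r c ≤ Module.finrank ℂ U ∧
      ∀ x ∈ U, ∀ z ∈ U, a x z = 0 := by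
    intro C
    induction C with
    | zero => intro _; exact ⟨⊥, by simp, by simp, by simp⟩
    | succ C ih =>
      intro hC
      obtain ⟨U, hU1, hU2, hU3⟩ := ih (by omega)
      obtain ⟨W, hW1, hW2, hW3⟩ := hchain C (by omega)
      have hST : Disjoint {k | cls b M k < C} {k | cls b M k = C} := by
        rw [Set.disjoint_left]; intro k hk hk'
        simp only [Set.mem_ofPred_eq] at hk hk'; omega
      have hfin : ∀ S : Set (Fin (b + M) ⊕ Fin b), FiniteDimensional ℂ (Submodule.span ℂ (e '' S)) :=
        fun S => FiniteDimensional.span_of_finite ℂ (Set.toFinite _)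
      have hfU : FiniteDimensional ℂ U := by
        have := hfin {k | cls b M k < C}
        exact Submodule.finiteDimensional_of_le hU1
      have hfW : FiniteDimensional ℂ W := by
        have := hfin {k | cls b M k = C}
        exact Submodule.finiteDimensional_of_le hW1
      refine ⟨U ⊔ W, sup_le (hU1.trans (Submodule.span_mono (Set.image_mono ?_)))
        (hW1.trans (Submodule.span_mono (Set.image_mono ?_))), ?_, ?_⟩
      · intro k hk; simp only [Set.mem_ofPred_eq] at hk ⊢; omega
      · intro k hk; simp only [Set.mem_ofPred_eq] at hk ⊢; omega
      · have hdis : Disjoint U W := (he.disjoint_span_image hST).mono hU1 hW1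
        have := Submodule.finrank_sup_add_finrank_inf_eq U W
        rw [hdis.eq_bot, finrank_bot] at this
        rw [Finset.sum_range_succ]; omega
      · intro x hx z hz
        obtain ⟨x1, hx1, x2, hx2, rfl⟩ := Submodule.mem_sup.mp hx
        obtain ⟨z1, hz1, z2, hz2, rfl⟩ := Submodule.mem_sup.mp hz
        simp [hU3 x1 hx1 z1 hz1, hW3 x2 hx2 z2 hz2,
          hspanort _ _ hST x1 (hU1 hx1) z2 (hW1 hz2),
          hspanort _ _ hST.symm x2 (hW1 hx2) z1 (hU1 hz1)]
  obtain ⟨U, hU1, hU2, hU3⟩ := key M le_rfl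
  exact ⟨U, hU1.trans (Submodule.span_mono (Set.image_subset_range _ _)), hsum.trans hU2, hU3⟩

lemma exists_sorted {ι : Type*} (s : Finset ι) (x : ι → ℝ) (n : ℕ) (hn : s.card = n) :
    ∃ f : Fin n → ι, Function.Injective f ∧ (∀ j, j ∈ s ↔ ∃ i, f i = j) ∧ Monotone (x ∘ f) := by
  classical
  let g : Fin n → ι := fun i => (s.equivFinOfCardEq hn).symm i
  have hg : Function.Injective g :=
    Subtype.val_injective.comp (s.equivFinOfCardEq hn).symm.injective
  refine ⟨g ∘ Tuple.sort (x ∘ g), hg.comp (Equiv.injective _), ?_, Tuple.monotone_sort (x ∘ g)⟩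
  intro j
  constructor
  · intro hj
    refine ⟨(Tuple.sort (x ∘ g)).symm (s.equivFinOfCardEq hn ⟨j, hj⟩), ?_⟩
    simp [g]
  · rintro ⟨i, rfl⟩
    simp [g]

lemma exists_between_avoid (p q : ℝ) (h : p < q) (S : Finset ℝ) : ∃ ξ, p < ξ ∧ ξ < q ∧ ξ ∉ S := by
  obtain ⟨ξ, h1, h2⟩ := (Set.Ioo_infinite h).exists_notMem_finset S
  exact ⟨ξ, h1.1, h1.2, h2⟩

lemma diag_isotropic (a : V →ₗ⋆[ℂ] V →ₗ[ℂ] ℂ) (m k : ℕ) (e : Fin m → V)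
    (he : LinearIndependent ℂ e) (hort : ∀ i j, i ≠ j → a (e i) (e j) = 0)
    (d : Fin m → ℂ) (hd : ∀ j, a (e j) (e j) = d j) (hd0 : ∀ j, d j ≠ 0)
    (hanti : ∀ i j, ∀ c : ℝ, 0 < c → d i ≠ -c * d j)
    (E : Finset ℂ) (hE : (0 : ℂ) ∉ E)
    (hcount : ∀ ω : ℂ, (∀ ε ∈ E, (ω * ε).re ≠ 0) → (∀ j, (ω * d j).re ≠ 0) →
      k ≤ (Finset.univ.filter (fun j => 0 < (ω * d j).re)).card) :
    ∃ U : Submodule ℂ V, U ≤ Submodule.span ℂ (Set.range e) ∧ k ≤ Module.finrank ℂ U ∧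
      ∀ x ∈ U, ∀ z ∈ U, a x z = 0 := by
  classical
  set E' : Finset ℂ := insert 1 (E ∪ Finset.univ.image d) with hE'
  have hE'0 : ∀ ε ∈ E', ε ≠ 0 := by
    intro ε hε
    simp only [hE', Finset.mem_insert, Finset.mem_union, Finset.mem_image, Finset.mem_univ,
      true_and] at hε
    rcases hε with rfl | hε | ⟨j, rfl⟩
    · exact one_ne_zero
    · rintro rfl; exact hE hε
    · exact hd0 j
  let cnt : ℂ → ℕ := fun ω => (Finset.univ.filter (fun j => 0 < (ω * d j).re)).card
  let Good : ℂ → Prop := fun ω => ∀ ε ∈ E', (ω * ε).re ≠ 0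
  have hGoodd : ∀ ω, Good ω → ∀ j, (ω * d j).re ≠ 0 := fun ω h j => h _ (by simp [hE'])
  have hGoodk : ∀ ω, Good ω → k ≤ cnt ω := fun ω h =>
    hcount ω (fun ε hε => h ε (by simp [hE', hε])) (hGoodd ω h)
  have hexg : ∃ n, ∃ ω, Good ω ∧ cnt ω = n := by
    obtain ⟨ξ, -, -, hξ⟩ := exists_between_avoid 0 1 one_pos (E'.image (fun ε => ε.re / ε.im))
    refine ⟨_, 1 + Complex.I * ξ, ?_, rfl⟩
    intro ε hε h0
    have h1 : ε.re - ξ * ε.im = 0 := by simpa using h0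
    by_cases him : ε.im = 0
    · apply hE'0 ε hε
      apply Complex.ext
      · simpa [him] using h1
      · simpa using him
    · apply hξ
      rw [Finset.mem_image]
      exact ⟨ε, hε, by field_simp; linarith⟩
  set b := Nat.find hexg with hb
  obtain ⟨ω₀, hω₀, hcnt⟩ := Nat.find_spec hexg
  have hmin : ∀ ω, Good ω → b ≤ cnt ω := fun ω h => Nat.find_min' hexg ⟨ω, h, rfl⟩
  rw [← hb] at hcnt
  have hkb : k ≤ b := hcnt ▸ hGoodk ω₀ hω₀
  have hω₀0 : ω₀ ≠ 0 := by
    rintro rfl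
    exact hω₀ 1 (by simp [hE']) (by simp)
  set σ : Fin m → ℝ := fun j => (ω₀ * d j).re with hσ
  set x : Fin m → ℝ := fun j => (ω₀ * d j).im / (ω₀ * d j).re with hx
  have hσ0 : ∀ j, σ j ≠ 0 := hGoodd ω₀ hω₀
  have hσx : ∀ j, ω₀ * d j = σ j * (1 + Complex.I * x j) := by
    intro j
    have h := hσ0 j
    simp only [hx, hσ] at h ⊢
    generalize ω₀ * d j = z at h ⊢
    apply Complex.ext
    · simp [-Complex.ofReal_div]
    · simp [-Complex.ofReal_div]
      field_simp
  set Bad : Finset ℝ := E'.image (fun ε => (ω₀ * ε).im / (ω₀ * ε).re) with hBad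
  have hval : ∀ (ξ : ℝ) (j : Fin m), (ω₀ * (-Complex.I - ξ) * d j).re = σ j * (x j - ξ) := by
    intro ξ j
    rw [mul_right_comm, hσx]
    simp
    ring
  have hgood1 : ∀ ξ : ℝ, ξ ∉ Bad → Good (ω₀ * (-Complex.I - ξ)) := by
    intro ξ hξ ε hε h0
    apply hξ
    have h1 := hω₀ ε hε
    rw [mul_right_comm] at h0
    have h2 : (ω₀ * ε).im - ξ * (ω₀ * ε).re = 0 := by
      have : (ω₀ * ε * (-Complex.I - ξ)).re = (ω₀ * ε).im - ξ * (ω₀ * ε).re := by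
        generalize ω₀ * ε = z
        simp; ring
      rw [← this]; exact h0
    rw [hBad, Finset.mem_image]
    exact ⟨ε, hε, by field_simp; linarith⟩
  have hneg : ∀ ω, Good ω → Good (-ω) := by
    intro ω h ε hε h0
    apply h ε hε
    simpa [sub_eq_zero, neg_add_eq_zero, eq_comm] using h0
  have hc1 : ∀ ξ : ℝ, ξ ∉ Bad → b ≤ (Finset.univ.filter (fun j => 0 < σ j * (x j - ξ))).card := by
    intro ξ hξ
    have := hmin _ (hgood1 ξ hξ)
    simp only [cnt, hval] at this
    exact this
  have hc2 : ∀ ξ : ℝ, ξ ∉ Bad → b ≤ (Finset.univ.filter (fun j => σ j * (x j - ξ) < 0)).card := by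
    intro ξ hξ
    have := hmin _ (hneg _ (hgood1 ξ hξ))
    simp only [cnt, neg_mul, Complex.neg_re, hval, neg_pos] at this
    simpa only [neg_mul] using this
  set Ls := Finset.univ.filter (fun j => 0 < σ j) with hLs
  set Us := Finset.univ.filter (fun j => σ j < 0) with hUs
  have hLc : Ls.card = b := hcnt
  have hUc : b ≤ Us.card := by
    have := hmin _ (hneg _ hω₀)
    simp only [cnt, neg_mul, Complex.neg_re, neg_pos] at this
    exact this
  obtain ⟨M, hM⟩ := Nat.exists_eq_add_of_le hUc
  obtain ⟨l, hlinj, hlmem, hlmono⟩ := exists_sorted Ls x b hLc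
  obtain ⟨u, huinj, humem, humono⟩ := exists_sorted Us x (b + M) hM
  have hlσ : ∀ i, 0 < σ (l i) := fun i => by
    have := (hlmem (l i)).mpr ⟨i, rfl⟩
    simpa [hLs] using this
  have huσ : ∀ i, σ (u i) < 0 := fun i => by
    have := (humem (u i)).mpr ⟨i, rfl⟩
    simpa [hUs] using this
  have hne : ∀ i j, x (u i) ≠ x (l j) := by
    intro i j hij
    have h1 := huσ i
    have h2 := hlσ j
    apply hanti (u i) (l j) (-(σ (u i)) / σ (l j)) (div_pos (by linarith) h2)
    have e1 := hσx (u i)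
    have e2 := hσx (l j)
    rw [hij] at e1
    apply mul_left_cancel₀ hω₀0
    rw [e1]
    have h3 : (σ (l j) : ℂ) ≠ 0 := by exact_mod_cast h2.ne'
    rw [mul_left_comm, e2]
    push_cast
    field_simp
  have hcase : ∀ j, (∃ i, u i = j) ∨ (∃ i, l i = j) := by
    intro j
    rcases lt_or_gt_of_ne (hσ0 j) with h | h
    · exact Or.inl ((humem j).mp (by simp [hUs, h]))
    · exact Or.inr ((hlmem j).mp (by simp [hLs, h]))
  have hw : Function.Injective (Sum.elim u l) := by
    apply Function.Injective.sumElim huinj hlinj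
    intro i j h
    have h1 := huσ i
    have h2 := hlσ j
    rw [h] at h1
    linarith
  obtain ⟨U, hU1, hU2, hU3⟩ := interlace_isotropic (ω₀ • a) b M (e ∘ Sum.elim u l) (he.comp _ hw)
    (fun i j hij => by
      have := hort (Sum.elim u l i) (Sum.elim u l j) (fun h => hij (hw h))
      simp [this])
    (σ ∘ Sum.elim u l) (x ∘ Sum.elim u l) (fun q => by
      simp only [LinearMap.smul_apply, Function.comp, hd, smul_eq_mul]
      exact hσx _)
    (fun i => huσ i) (fun i => hlσ i)
    (by
      intro i hi
      simp only [Function.comp, Sum.elim_inl, Sum.elim_inr]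
      by_contra hcon
      have hlt := lt_of_le_of_ne (not_lt.mp hcon) (hne _ _).symm
      obtain ⟨ξ, hξ1, hξ2, hξ3⟩ := exists_between_avoid _ _ hlt Bad
      have hc := hc1 ξ hξ3
      have hsub : (Finset.univ.filter (fun j => 0 < σ j * (x j - ξ))) ⊆
          (Finset.Iio (⟨i, by omega⟩ : Fin (b + M))).image u ∪
          (Finset.Ioi (⟨i, hi⟩ : Fin b)).image l := by
        intro j hj
        simp only [Finset.mem_filter, Finset.mem_univ, true_and] at hj
        simp only [Finset.mem_union, Finset.mem_image, Finset.mem_Iio, Finset.mem_Ioi]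
        rcases hcase j with ⟨p, rfl⟩ | ⟨p, rfl⟩
        · left
          refine ⟨p, ?_, rfl⟩
          by_contra hp
          have h1 : x (u ⟨i, by omega⟩) ≤ x (u p) := humono (not_lt.mp hp)
          have h2 := huσ p
          nlinarith
        · right
          refine ⟨p, ?_, rfl⟩
          by_contra hp
          have h1 : x (l p) ≤ x (l ⟨i, hi⟩) := hlmono (not_lt.mp hp)
          have h2 := hlσ p
          nlinarith
      have h3 := (Finset.card_le_card hsub).trans (Finset.card_union_le _ _)
      have h4 : ((Finset.Iio (⟨i, by omega⟩ : Fin (b + M))).image u).card ≤ i :=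
        Finset.card_image_le.trans (by simp)
      have h5 : ((Finset.Ioi (⟨i, hi⟩ : Fin b)).image l).card ≤ b - 1 - i :=
        Finset.card_image_le.trans (by simp)
      omega)
    (by
      intro i hi
      simp only [Function.comp, Sum.elim_inl, Sum.elim_inr]
      by_contra hcon
      have hlt := lt_of_le_of_ne (not_lt.mp hcon) (hne _ _)
      obtain ⟨ξ, hξ1, hξ2, hξ3⟩ := exists_between_avoid _ _ hlt Bad
      have hc := hc2 ξ hξ3
      have hsub : (Finset.univ.filter (fun j => σ j * (x j - ξ) < 0)) ⊆
          (Finset.Ioi (⟨i + M, by omega⟩ : Fin (b + M))).image u ∪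
          (Finset.Iio (⟨i, hi⟩ : Fin b)).image l := by
        intro j hj
        simp only [Finset.mem_filter, Finset.mem_univ, true_and] at hj
        simp only [Finset.mem_union, Finset.mem_image, Finset.mem_Iio, Finset.mem_Ioi]
        rcases hcase j with ⟨p, rfl⟩ | ⟨p, rfl⟩
        · left
          refine ⟨p, ?_, rfl⟩
          by_contra hp
          have h1 : x (u p) ≤ x (u ⟨i + M, by omega⟩) := humono (not_lt.mp hp)
          have h2 := huσ p
          nlinarith
        · right
          refine ⟨p, ?_, rfl⟩
          by_contra hp
          have h1 : x (l ⟨i, hi⟩) ≤ x (l p) := hlmono (not_lt.mp hp)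
          have h2 := hlσ p
          nlinarith
      have h3 := (Finset.card_le_card hsub).trans (Finset.card_union_le _ _)
      have h4 : ((Finset.Ioi (⟨i + M, by omega⟩ : Fin (b + M))).image u).card ≤ b + M - 1 - (i + M) :=
        Finset.card_image_le.trans (by simp)
      have h5 : ((Finset.Iio (⟨i, hi⟩ : Fin b)).image l).card ≤ i :=
        Finset.card_image_le.trans (by simp)
      omega)
  refine ⟨U, hU1.trans (Submodule.span_mono (Set.range_comp_subset_range _ _)), hkb.trans hU2, ?_⟩
  intro y hy z hz
  have := hU3 y hy z hz
  simpa [hω₀0] using this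

section form

set_option linter.unusedSectionVars false

variable [FiniteDimensional ℂ V]

/-- `k` nonnegative dimensions for all `Re (ω a)`, for `ω` off finitely many lines. -/
def PosOn (a : V →ₗ⋆[ℂ] V →ₗ[ℂ] ℂ) (E : Finset ℂ) (Q : Submodule ℂ V) (k : ℕ) : Prop :=
  ∀ ω : ℂ, (∀ ε ∈ E, (ω * ε).re ≠ 0) →
    ∃ P : Submodule ℂ V, P ≤ Q ∧ k ≤ Module.finrank ℂ P ∧ ∀ x ∈ P, 0 ≤ (ω * a x x).re

/-- An eigenvector of the pencil of the form. -/
def IsEig (a : V →ₗ⋆[ℂ] V →ₗ[ℂ] ℂ) (Q : Submodule ℂ V) (v : V) : Prop :=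
  v ∈ Q ∧ v ≠ 0 ∧ ∃ α β : ℂ, (α ≠ 0 ∨ β ≠ 0) ∧
    ∀ y ∈ Q, α * a y v = β * (starRingEnd ℂ) (a v y)

lemma exists_isEig (a : V →ₗ⋆[ℂ] V →ₗ[ℂ] ℂ) (Q : Submodule ℂ V) (hQ : Q ≠ ⊥) :
    ∃ v, IsEig a Q v := by
  have hnt : Nontrivial Q := Submodule.nontrivial_iff_ne_bot.mpr hQ
  let B := Module.finBasis ℂ Q
  let T1 : Q →ₗ[ℂ] (Fin (Module.finrank ℂ Q) → ℂ) :=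
    { toFun := fun v i => a (B i : V) (v : V)
      map_add' := by intro x y; ext i; simp
      map_smul' := by intro c x; ext i; simp }
  let T2 : Q →ₗ[ℂ] (Fin (Module.finrank ℂ Q) → ℂ) :=
    { toFun := fun v i => (starRingEnd ℂ) (a (v : V) (B i : V))
      map_add' := by intro x y; ext i; simp
      map_smul' := by intro c x; ext i; simp }
  have hmain : ∀ (v : Q) (α β : ℂ), α • T1 v = β • T2 v →
      ∀ y ∈ Q, α * a y v = β * (starRingEnd ℂ) (a v y) := by
    intro v α β h y hy
    have hrep := B.sum_repr ⟨y, hy⟩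
    have hrep' : ∑ i, (B.repr ⟨y, hy⟩ i) • (B i : V) = y := by
      have := congrArg (Q.subtype) hrep
      rw [map_sum] at this
      exact this
    generalize B.repr ⟨y, hy⟩ = c at hrep'
    rw [← hrep']
    simp only [map_sum, LinearMap.sum_apply, map_smulₛₗ, LinearMap.smul_apply, smul_eq_mul,
      RingHom.id_apply, Finset.mul_sum, map_mul]
    refine Finset.sum_congr rfl (fun i _ => ?_)
    have hi : α * a (B i : V) v = β * (starRingEnd ℂ) (a v (B i : V)) := congrFun h i
    linear_combination ((starRingEnd ℂ) (c i)) * hi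
  by_cases hinj : Function.Injective T1
  · have hfr : Module.finrank ℂ Q = Module.finrank ℂ (Fin (Module.finrank ℂ Q) → ℂ) := by simp
    let T1e := LinearEquiv.ofInjectiveOfFinrankEq T1 hinj hfr
    let C : Module.End ℂ Q := T1e.symm.toLinearMap.comp T2
    obtain ⟨μ, hμ⟩ := Module.End.exists_eigenvalue C
    obtain ⟨v, hv⟩ := hμ.exists_hasEigenvector
    have h1 : C v = μ • v := hv.apply_eq_smul
    have h2 : T2 v = μ • T1 v := by
      have := congrArg T1e h1
      simp only [C, LinearMap.comp_apply, LinearEquiv.coe_coe, LinearEquiv.apply_symm_apply,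
        map_smul] at this
      rw [this]; rfl
    refine ⟨v, v.2, by simpa using hv.2, μ, 1, Or.inr one_ne_zero, hmain v _ _ ?_⟩
    rw [h2]; simp
  · rw [← LinearMap.ker_eq_bot, Submodule.eq_bot_iff] at hinj
    push Not at hinj
    obtain ⟨v, hv, hv0⟩ := hinj
    refine ⟨v, v.2, by simpa using hv0, 1, 0, Or.inl one_ne_zero, hmain v _ _ ?_⟩
    rw [LinearMap.mem_ker.mp hv]; simp

lemma finrank_inf_ker (P : Submodule ℂ V) (φ : V →ₗ[ℂ] ℂ) :
    Module.finrank ℂ P ≤ Module.finrank ℂ (P ⊓ LinearMap.ker φ : Submodule ℂ V) + 1 := by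
  have h1 := Submodule.finrank_sup_add_finrank_inf_eq P (LinearMap.ker φ)
  have h2 := LinearMap.finrank_range_add_finrank_ker φ
  have h3 : Module.finrank ℂ (LinearMap.range φ) ≤ 1 := by
    simpa using Submodule.finrank_le (LinearMap.range φ)
  have h4 := Submodule.finrank_le (P ⊔ LinearMap.ker φ)
  omega

lemma eig_direction (α β : ℂ) (h : α ≠ 0 ∨ β ≠ 0) : ∃ ε : ℂ, ε ≠ 0 ∧ ∀ ω B B' : ℂ,
    (ω * ε).re ≠ 0 → α * B = β * B' → ω * B + (starRingEnd ℂ) ω * B' = 0 → B = 0 ∧ B' = 0 := by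
  have hdet : ∀ ω B B' : ℂ, ω * β + (starRingEnd ℂ) ω * α ≠ 0 → α * B = β * B' →
      ω * B + (starRingEnd ℂ) ω * B' = 0 → B = 0 ∧ B' = 0 := by
    intro ω B B' hne h1 h2
    constructor
    · apply (mul_eq_zero.mp _).resolve_left hne
      linear_combination ((starRingEnd ℂ) ω) * h1 + β * h2
    · apply (mul_eq_zero.mp _).resolve_left hne
      linear_combination (-ω) * h1 + α * h2
  by_cases hab : ‖α‖ = ‖β‖
  · have hα : α ≠ 0 := by
      rintro rfl
      simp only [norm_zero] at hab
      rcases h with h | h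
      · exact h rfl
      · exact h (norm_eq_zero.mp hab.symm)
    obtain ⟨ε, hε⟩ := IsAlgClosed.exists_pow_nat_eq (β / α) (n := 2) two_pos
    have hn : ‖ε‖ = 1 := by
      have := congrArg norm hε
      rw [norm_pow, norm_div, ← hab, div_self (norm_ne_zero_iff.mpr hα)] at this
      exact (pow_eq_one_iff_of_nonneg (norm_nonneg _) two_ne_zero).mp this
    have hε0 : ε ≠ 0 := by rintro rfl; simp at hn
    have hβ : β = α * ε ^ 2 := by rw [hε]; field_simp
    have hεε : ε * (starRingEnd ℂ) ε = 1 := by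
      rw [Complex.mul_conj, Complex.normSq_eq_norm_sq, hn]; simp
    refine ⟨ε, hε0, fun ω B B' hre h1 h2 => hdet ω B B' ?_ h1 h2⟩
    have : ω * β + (starRingEnd ℂ) ω * α = α * ε * (ω * ε + (starRingEnd ℂ) (ω * ε)) := by
      rw [hβ, map_mul]
      linear_combination (-(α * (starRingEnd ℂ) ω)) * hεε
    rw [this, Complex.add_conj]
    have : ((2 * (ω * ε).re : ℝ) : ℂ) ≠ 0 := by
      exact_mod_cast mul_ne_zero two_ne_zero hre
    exact mul_ne_zero (mul_ne_zero hα hε0) this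
  · refine ⟨1, one_ne_zero, fun ω B B' hre h1 h2 => hdet ω B B' ?_ h1 h2⟩
    intro h0
    have hω : ω ≠ 0 := by rintro rfl; simp at hre
    have h3 : ω * β = -((starRingEnd ℂ) ω * α) := by linear_combination h0
    have := congrArg norm h3
    rw [norm_neg, norm_mul, norm_mul, RCLike.norm_conj] at this
    exact hab (mul_left_cancel₀ (norm_ne_zero_iff.mpr hω) this).symm

lemma nonneg_cross (a : V →ₗ⋆[ℂ] V →ₗ[ℂ] ℂ) (P : Submodule ℂ V) (ω : ℂ)
    (hP : ∀ x ∈ P, 0 ≤ (ω * a x x).re) (v : V) (hv : v ∈ P) (hvv : a v v = 0) (y : V) (hy : y ∈ P) :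
    ω * a y v + (starRingEnd ℂ) ω * (starRingEnd ℂ) (a v y) = 0 := by
  set h := ω * a y v + (starRingEnd ℂ) ω * (starRingEnd ℂ) (a v y) with hh
  by_contra hne
  have h1 : ∀ t : ℝ, 0 ≤ -t * Complex.normSq h + (ω * a y y).re := by
    intro t
    have h2 := hP ((-(t : ℂ) * (starRingEnd ℂ) h) • v + y)
      (P.add_mem (P.smul_mem _ hv) hy)
    have h3 : (ω * a ((-(t : ℂ) * (starRingEnd ℂ) h) • v + y)
        ((-(t : ℂ) * (starRingEnd ℂ) h) • v + y)).re =
        -t * Complex.normSq h + (ω * a y y).re := by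
      simp only [map_add, map_smulₛₗ, LinearMap.add_apply, LinearMap.smul_apply, smul_eq_mul,
        hvv, RingHom.id_apply, map_mul, map_neg, Complex.conj_conj, Complex.conj_ofReal]
      have h4 : ((starRingEnd ℂ) h * (ω * a y v)).re + (h * (ω * a v y)).re = Complex.normSq h := by
        have h5 : (h * (ω * a v y)).re =
            ((starRingEnd ℂ) h * ((starRingEnd ℂ) ω * (starRingEnd ℂ) (a v y))).re := by
          rw [← map_mul, ← map_mul, Complex.conj_re]
        rw [h5, ← Complex.add_re, ← mul_add, ← hh, mul_comm, Complex.mul_conj, Complex.ofReal_re]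
      have h7 : ∀ z : ℂ, ((-(t : ℂ)) * z).re = -t * z.re := fun z => by simp
      rw [← h4, ← Complex.add_re, ← h7, ← Complex.add_re]
      congr 1
      ring
    rwa [h3] at h2
  have h2 := h1 (((ω * a y y).re + 1) / Complex.normSq h)
  have h3 : 0 < Complex.normSq h := Complex.normSq_pos.mpr hne
  have h4 : ((ω * a y y).re + 1) / Complex.normSq h * Complex.normSq h = (ω * a y y).re + 1 := by
    field_simp
  linarith

/-- Vectors orthogonal on both sides to `v`. -/
def perp (a : V →ₗ⋆[ℂ] V →ₗ[ℂ] ℂ) (v : V) : Submodule ℂ V where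
  carrier := {y | a y v = 0 ∧ a v y = 0}
  zero_mem' := by simp
  add_mem' := by
    rintro x y ⟨h1, h2⟩ ⟨h3, h4⟩
    exact ⟨by simp [h1, h3], by simp [h2, h4]⟩
  smul_mem' := by
    rintro c x ⟨h1, h2⟩
    exact ⟨by simp [h1], by simp [h2]⟩

lemma mem_perp (a : V →ₗ⋆[ℂ] V →ₗ[ℂ] ℂ) (v y : V) : y ∈ perp a v ↔ a y v = 0 ∧ a v y = 0 :=
  Iff.rfl

lemma isotropic_sup (v : V) (U : Submodule ℂ V) (f : V → V → Prop)
    (hf : ∀ x ∈ U, ∀ z ∈ U, ∀ s t : ℂ, f (x + s • v) (z + t • v)) :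
    ∀ x ∈ U ⊔ Submodule.span ℂ {v}, ∀ z ∈ U ⊔ Submodule.span ℂ {v}, f x z := by
  intro x hx z hz
  obtain ⟨x1, hx1, x2, hx2, rfl⟩ := Submodule.mem_sup.mp hx
  obtain ⟨z1, hz1, z2, hz2, rfl⟩ := Submodule.mem_sup.mp hz
  obtain ⟨s, rfl⟩ := Submodule.mem_span_singleton.mp hx2
  obtain ⟨t, rfl⟩ := Submodule.mem_span_singleton.mp hz2
  exact hf _ hx1 _ hz1 s t

lemma form_perp (a : V →ₗ⋆[ℂ] V →ₗ[ℂ] ℂ) (v : V) (hvv : a v v = 0) (x z : V)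
    (hx : x ∈ perp a v) (hz : z ∈ perp a v) (s t : ℂ) :
    a (x + s • v) (z + t • v) = a x z := by
  simp [hx.1, hz.2, hvv]

lemma finrank_sup_span (U : Submodule ℂ V) (v : V) (hv : v ∉ U) :
    Module.finrank ℂ (U ⊔ Submodule.span ℂ {v} : Submodule ℂ V) = Module.finrank ℂ U + 1 := by
  have h0 : v ≠ 0 := by rintro rfl; exact hv U.zero_mem
  have h1 := Submodule.finrank_sup_add_finrank_inf_eq U (Submodule.span ℂ {v})
  have h2 : U ⊓ Submodule.span ℂ {v} = ⊥ := by
    rw [Submodule.eq_bot_iff]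
    intro x hx
    obtain ⟨hx1, hx2⟩ := Submodule.mem_inf.mp hx
    obtain ⟨c, rfl⟩ := Submodule.mem_span_singleton.mp hx2
    by_cases hc : c = 0
    · simp [hc]
    · exact absurd ((U.smul_mem_iff hc).mp hx1) hv
  rw [h2, finrank_span_singleton h0, finrank_bot] at h1
  omega

lemma reduction (a : V →ₗ⋆[ℂ] V →ₗ[ℂ] ℂ) (Q : Submodule ℂ V) (v : V) (hv : IsEig a Q v)
    (hvv : a v v = 0) (E : Finset ℂ) (hE : (0 : ℂ) ∉ E) (k : ℕ) (hP : PosOn a E Q (k + 1)) :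
    ∃ (Q' : Submodule ℂ V) (E' : Finset ℂ), Q' ≤ Q ∧ Q' ≤ perp a v ∧ v ∉ Q' ∧ (0 : ℂ) ∉ E' ∧
      PosOn a E' Q' k := by
  classical
  obtain ⟨hvQ, hv0, α, β, hαβ, hrel⟩ := hv
  obtain ⟨ε, hε0, hε⟩ := eig_direction α β hαβ
  obtain ⟨Y, hY⟩ := Submodule.exists_isCompl (Submodule.span ℂ {v})
  have hvY : v ∉ Y := by
    intro h
    have := hY.disjoint.le_bot (Submodule.mem_inf.mpr ⟨Submodule.mem_span_singleton_self v, h⟩)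
    exact hv0 (by simpa using this)
  refine ⟨Q ⊓ perp a v ⊓ Y, insert ε E, inf_le_left.trans inf_le_left,
    inf_le_left.trans inf_le_right, fun h => hvY h.2, ?_, ?_⟩
  · rw [Finset.mem_insert]
    rintro (h | h)
    · exact hε0 h.symm
    · exact hE h
  intro ω hω
  have hωε := hω ε (Finset.mem_insert_self _ _)
  obtain ⟨P, hPQ, hPk, hPn⟩ := hP ω (fun e he => hω e (Finset.mem_insert_of_mem he))
  have hvperp : v ∈ perp a v := ⟨hvv, hvv⟩
  -- P1
  have hP1 : k + 1 ≤ Module.finrank ℂ (P ⊓ perp a v ⊔ Submodule.span ℂ {v} : Submodule ℂ V) := by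
    by_cases hvP : v ∈ P
    · have : P ≤ P ⊓ perp a v ⊔ Submodule.span ℂ {v} := by
        refine le_trans ?_ le_sup_left
        refine le_inf le_rfl ?_
        intro y hy
        have := hε ω _ _ hωε (hrel y (hPQ hy)) (nonneg_cross a P ω hPn v hvP hvv y hy)
        exact ⟨this.1, by simpa using this.2⟩
      exact hPk.trans (Submodule.finrank_mono this)
    · rw [finrank_sup_span _ _ (fun h => hvP (Submodule.mem_inf.mp h).1)]
      let φ : V →ₗ[ℂ] ℂ :=
        { toFun := fun y => (starRingEnd ℂ) ω * (starRingEnd ℂ) (a y v) + ω * a v y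
          map_add' := by intro x y; simp; ring
          map_smul' := by intro c x; simp; ring }
      have h1 := finrank_inf_ker P φ
      have h2 : P ⊓ LinearMap.ker φ ≤ P ⊓ perp a v := by
        refine le_inf inf_le_left ?_
        rintro y ⟨hy, hyφ⟩
        have h3 : (starRingEnd ℂ) ω * (starRingEnd ℂ) (a y v) + ω * a v y = 0 := hyφ
        have h4 : ω * a y v + (starRingEnd ℂ) ω * (starRingEnd ℂ) (a v y) = 0 := by
          have := congrArg (starRingEnd ℂ) h3
          simpa using this
        have := hε ω _ _ hωε (hrel y (hPQ hy)) h4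
        exact ⟨this.1, by simpa using this.2⟩
      have := Submodule.finrank_mono h2
      omega
  refine ⟨(P ⊓ perp a v ⊔ Submodule.span ℂ {v}) ⊓ Y, ?_, ?_, ?_⟩
  · refine inf_le_inf_right _ ?_
    refine sup_le (inf_le_inf_right _ hPQ) ?_
    rw [Submodule.span_singleton_le_iff_mem]
    exact ⟨hvQ, hvperp⟩
  · have h1 := Submodule.finrank_sup_add_finrank_inf_eq
      (P ⊓ perp a v ⊔ Submodule.span ℂ {v}) Y
    have h2 := Submodule.finrank_add_eq_of_isCompl hY
    rw [finrank_span_singleton hv0] at h2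
    have h4 := Submodule.finrank_le (P ⊓ perp a v ⊔ Submodule.span ℂ {v} ⊔ Y)
    omega
  · intro x hx
    obtain ⟨x1, hx1, x2, hx2, rfl⟩ := Submodule.mem_sup.mp hx.1
    obtain ⟨s, rfl⟩ := Submodule.mem_span_singleton.mp hx2
    rw [form_perp a v hvv _ _ hx1.2 hx1.2]
    exact hPn _ hx1.1

lemma diagonalize (a : V →ₗ⋆[ℂ] V →ₗ[ℂ] ℂ) : ∀ (m : ℕ) (Q : Submodule ℂ V),
    Module.finrank ℂ Q = m → (∀ v, IsEig a Q v → a v v ≠ 0) →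
    ∃ e : Fin m → V, (∀ i, e i ∈ Q) ∧ (∀ i j, i ≠ j → a (e i) (e j) = 0) ∧
      (∀ i, a (e i) (e i) ≠ 0) ∧
      ∀ i, ∀ y ∈ Q, (starRingEnd ℂ) (a (e i) (e i)) * a y (e i) =
        a (e i) (e i) * (starRingEnd ℂ) (a (e i) y) := by
  intro m
  induction m with
  | zero =>
    intro Q _ _
    exact ⟨Fin.elim0, fun i => i.elim0, fun i => i.elim0, fun i => i.elim0, fun i => i.elim0⟩
  | succ m ih =>
    intro Q hQ hno
    have hQ0 : Q ≠ ⊥ := by rintro rfl; simp at hQ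
    obtain ⟨v, hv⟩ := exists_isEig a Q hQ0
    have hd := hno v hv
    obtain ⟨hvQ, hv0, α, β, hαβ, hrel⟩ := hv
    have hrv := hrel v hvQ
    have hdc : (starRingEnd ℂ) (a v v) ≠ 0 := by simpa using hd
    have hα : α ≠ 0 := by
      rintro rfl
      rcases hαβ with h | h
      · exact h rfl
      · rw [zero_mul] at hrv
        exact mul_ne_zero h hdc hrv.symm
    have hrel2 : ∀ y ∈ Q, (starRingEnd ℂ) (a v v) * a y v =
        a v v * (starRingEnd ℂ) (a v y) := by
      intro y hy
      have := hrel y hy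
      apply mul_left_cancel₀ hα
      linear_combination ((starRingEnd ℂ) (a v v)) * this - ((starRingEnd ℂ) (a v y)) * hrv
    have hvn : v ∉ Q ⊓ LinearMap.ker (a v) := fun h => hd h.2
    have hperp : ∀ y ∈ Q ⊓ LinearMap.ker (a v), a y v = 0 ∧ a v y = 0 := by
      rintro y ⟨hy, hy2⟩
      have h3 : a v y = 0 := hy2
      refine ⟨?_, h3⟩
      have := hrel2 y hy
      rw [h3, map_zero, mul_zero] at this
      exact (mul_eq_zero.mp this).resolve_left hdc
    have hdec : ∀ y ∈ Q, ∃ y1 ∈ Q ⊓ LinearMap.ker (a v), ∃ s : ℂ, y = y1 + s • v := by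
      intro y hy
      refine ⟨y - (a v y / a v v) • v, ⟨Q.sub_mem hy (Q.smul_mem _ hvQ), ?_⟩, a v y / a v v,
        by simp⟩
      simp [hd]
    have hQ1 : Module.finrank ℂ (Q ⊓ LinearMap.ker (a v) : Submodule ℂ V) = m := by
      have h1 := finrank_inf_ker Q (a v)
      have h2 := finrank_sup_span _ _ hvn
      have h3 : Q ⊓ LinearMap.ker (a v) ⊔ Submodule.span ℂ {v} ≤ Q := by
        refine sup_le inf_le_left ?_
        rwa [Submodule.span_singleton_le_iff_mem]
      have := Submodule.finrank_mono h3
      omega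
    have hext : ∀ w, w ∈ Q ⊓ LinearMap.ker (a v) → ∀ α β : ℂ,
        (∀ y ∈ Q ⊓ LinearMap.ker (a v), α * a y w = β * (starRingEnd ℂ) (a w y)) →
        ∀ y ∈ Q, α * a y w = β * (starRingEnd ℂ) (a w y) := by
      intro w hw α β h y hy
      obtain ⟨y1, hy1, s, rfl⟩ := hdec y hy
      simpa [(hperp w hw).1, (hperp w hw).2] using h y1 hy1
    obtain ⟨e, he1, he2, he3, he4⟩ := ih _ hQ1 (by
      rintro w ⟨hw, hw0, α', β', hαβ', hw2⟩
      exact hno w ⟨hw.1, hw0, α', β', hαβ', hext w hw _ _ hw2⟩)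
    refine ⟨Fin.cons v e, ?_, ?_, ?_, ?_⟩
    · intro i
      refine Fin.cases ?_ (fun i => ?_) i
      · simpa using hvQ
      · simpa using (he1 i).1
    · intro i j
      refine Fin.cases ?_ (fun i => ?_) i <;> refine Fin.cases ?_ (fun j => ?_) j
      · simp
      · intro _; simpa using (hperp _ (he1 j)).2
      · intro _; simpa using (hperp _ (he1 i)).1
      · intro h; simpa using he2 i j (fun h' => h (by rw [h']))
    · intro i
      refine Fin.cases ?_ (fun i => ?_) i
      · simpa using hd
      · simpa using he3 i
    · intro i
      refine Fin.cases ?_ (fun i => ?_) i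
      · simpa using hrel2
      · simpa using hext _ (he1 i) _ _ (he4 i)

lemma indep_of_orth (a : V →ₗ⋆[ℂ] V →ₗ[ℂ] ℂ) (m : ℕ) (e : Fin m → V)
    (hort : ∀ i j, i ≠ j → a (e i) (e j) = 0) (hd : ∀ i, a (e i) (e i) ≠ 0) :
    LinearIndependent ℂ e := by
  rw [Fintype.linearIndependent_iff]
  intro g hg i
  have h := congrArg (a (e i)) hg
  rw [map_sum, map_zero, Finset.sum_eq_single i] at h
  · rw [map_smul, smul_eq_mul] at h
    exact (mul_eq_zero.mp h).resolve_right (hd i)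
  · intro j _ hj
    rw [map_smul, hort i j hj.symm, smul_zero]
  · simp

lemma form_sum (a : V →ₗ⋆[ℂ] V →ₗ[ℂ] ℂ) {ι : Type*} [Fintype ι] (e : ι → V)
    (hort : ∀ i j, i ≠ j → a (e i) (e j) = 0) (c : ι → ℂ) :
    a (∑ i, c i • e i) (∑ i, c i • e i) = ∑ i, (Complex.normSq (c i) : ℂ) * a (e i) (e i) := by
  classical
  simp only [map_sum, LinearMap.sum_apply, map_smulₛₗ, LinearMap.smul_apply, smul_eq_mul,
    RingHom.id_apply]
  refine Finset.sum_congr rfl (fun i _ => ?_)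
  rw [Finset.sum_eq_single i]
  · rw [← Complex.mul_conj]; ring
  · intro j _ hj
    simp [hort j i hj]
  · simp

theorem form_main (a : V →ₗ⋆[ℂ] V →ₗ[ℂ] ℂ) : ∀ (N : ℕ) (Q : Submodule ℂ V) (E : Finset ℂ) (k : ℕ),
    Module.finrank ℂ Q = N → (0 : ℂ) ∉ E → PosOn a E Q k →
    ∃ U : Submodule ℂ V, U ≤ Q ∧ k ≤ Module.finrank ℂ U ∧ ∀ x ∈ U, ∀ z ∈ U, a x z = 0 := by
  intro N
  induction N using Nat.strong_induction_on with
  | _ N ih =>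
  intro Q E k hN hE hP
  rcases k with _ | k
  · exact ⟨⊥, bot_le, Nat.zero_le _, by simp⟩
  by_cases hiso : ∃ v, IsEig a Q v ∧ a v v = 0
  · obtain ⟨v, hv, hvv⟩ := hiso
    obtain ⟨Q', E', hQ', hQp, hvQ', hE', hP'⟩ := reduction a Q v hv hvv E hE k hP
    have hlt : Q' < Q := lt_of_le_of_ne hQ' (by rintro rfl; exact hvQ' hv.1)
    obtain ⟨U, hU, hUk, hUi⟩ := ih _ (hN ▸ Submodule.finrank_lt_finrank_of_lt hlt) Q' E' k rfl hE' hP'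
    refine ⟨U ⊔ Submodule.span ℂ {v}, ?_, ?_, ?_⟩
    · refine sup_le (hU.trans hQ') ?_
      rw [Submodule.span_singleton_le_iff_mem]; exact hv.1
    · rw [finrank_sup_span U v (fun h => hvQ' (hU h))]; omega
    · refine isotropic_sup v U (fun x z => a x z = 0) ?_
      intro x hx z hz s t
      rw [form_perp a v hvv x z (hQp (hU hx)) (hQp (hU hz))]
      exact hUi x hx z hz
  · push Not at hiso
    obtain ⟨e, he1, he2, he3, he4⟩ := diagonalize a N Q hN hiso
    have hli := indep_of_orth a N e he2 he3
    have hspan : Submodule.span ℂ (Set.range e) ≤ Q := by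
      rw [Submodule.span_le]; rintro _ ⟨i, rfl⟩; exact he1 i
    suffices h : ∃ U, U ≤ Submodule.span ℂ (Set.range e) ∧ k + 1 ≤ Module.finrank ℂ U ∧
        ∀ x ∈ U, ∀ z ∈ U, a x z = 0 by
      obtain ⟨U, h1, h2, h3⟩ := h
      exact ⟨U, h1.trans hspan, h2, h3⟩
    refine diag_isotropic a N (k + 1) e hli he2 (fun j => a (e j) (e j))
      (fun j => rfl) he3 ?_ E hE ?_
    · intro i j c hc hcd
      have hij : i ≠ j := by
        rintro rfl
        have : ((1 + c : ℝ) : ℂ) * a (e i) (e i) = 0 := by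
          push_cast; linear_combination hcd
        rcases mul_eq_zero.mp this with h | h
        · have : (1 + c : ℝ) = 0 := by exact_mod_cast h
          linarith
        · exact he3 i h
      have hsq : ((Real.sqrt c : ℝ) : ℂ) * ((Real.sqrt c : ℝ) : ℂ) = (c : ℂ) := by
        rw [← Complex.ofReal_mul, Real.mul_self_sqrt hc.le]
      have hcc : (c : ℂ) ≠ 0 := by exact_mod_cast hc.ne'
      refine hiso (e i + ((Real.sqrt c : ℝ) : ℂ) • e j) ⟨Q.add_mem (he1 i) (Q.smul_mem _ (he1 j)),
        ?_, (starRingEnd ℂ) (a (e j) (e j)), a (e j) (e j), Or.inr (he3 j), ?_⟩ ?_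
      · intro h0
        have := congrArg (a (e i)) h0
        simp only [map_add, map_smul, he2 i j hij, smul_zero, add_zero, map_zero] at this
        exact he3 i this
      · intro y hy
        have hi := he4 i y hy
        have hj := he4 j y hy
        rw [hcd] at hi
        simp only [map_mul, map_neg, Complex.conj_ofReal] at hi
        have hi' : (starRingEnd ℂ) (a (e j) (e j)) * a y (e i) =
            a (e j) (e j) * (starRingEnd ℂ) (a (e i) y) := by
          apply mul_left_cancel₀ hcc
          linear_combination (-1 : ℂ) * hi
        simp only [map_add, map_smulₛₗ, LinearMap.add_apply, LinearMap.smul_apply, smul_eq_mul,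
          RingHom.id_apply, map_mul, Complex.conj_ofReal]
        linear_combination hi' + ((Real.sqrt c : ℝ) : ℂ) * hj
      · simp only [map_add, map_smulₛₗ, LinearMap.add_apply, LinearMap.smul_apply, smul_eq_mul,
          RingHom.id_apply, Complex.conj_ofReal, he2 i j hij, he2 j i hij.symm]
        linear_combination hcd + hsq * a (e j) (e j)
    · intro ω hω hω2
      obtain ⟨P, hPQ, hPk, hPn⟩ := hP ω hω
      classical
      let S := {j : Fin N // ¬ 0 < (ω * a (e j) (e j)).re}
      let f : S → V := fun j => e j
      have hfli : LinearIndependent ℂ f := hli.comp _ Subtype.val_injective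
      have hfr := finrank_span_eq_card hfli
      have hdis : P ⊓ Submodule.span ℂ (Set.range f) = ⊥ := by
        rw [Submodule.eq_bot_iff]
        rintro x ⟨hx1, hx2⟩
        obtain ⟨c, rfl⟩ := (Submodule.mem_span_range_iff_exists_fun ℂ).mp hx2
        have h5 := hPn _ hx1
        rw [form_sum a f (fun i j hij => he2 _ _ (fun h => hij (Subtype.ext h))) c,
          Finset.mul_sum, Complex.re_sum] at h5
        have h6 : ∀ i : S, (ω * ((Complex.normSq (c i) : ℂ) * a (f i) (f i))).re =
            Complex.normSq (c i) * (ω * a (f i) (f i)).re := by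
          intro i
          rw [mul_left_comm, Complex.re_ofReal_mul]
        simp only [h6] at h5
        have h7 : ∀ i : S, (ω * a (f i) (f i)).re < 0 := fun i =>
          lt_of_le_of_ne (not_lt.mp i.2) (hω2 i)
        have h8 : ∀ i ∈ (Finset.univ : Finset S),
            Complex.normSq (c i) * (ω * a (f i) (f i)).re ≤ 0 := fun i _ =>
          mul_nonpos_of_nonneg_of_nonpos (Complex.normSq_nonneg _) (h7 i).le
        have h9 := (Finset.sum_eq_zero_iff_of_nonpos h8).mp
          (le_antisymm (Finset.sum_nonpos h8) h5)
        refine Finset.sum_eq_zero (fun i hi => ?_)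
        have := (mul_eq_zero.mp (h9 i hi)).resolve_right (h7 i).ne
        rw [Complex.normSq_eq_zero.mp this, zero_smul]
      have hd := Submodule.finrank_sup_add_finrank_inf_eq P (Submodule.span ℂ (Set.range f))
      rw [hdis, finrank_bot, hfr] at hd
      have hle : P ⊔ Submodule.span ℂ (Set.range f) ≤ Q := by
        refine sup_le hPQ ?_
        rw [Submodule.span_le]; rintro _ ⟨i, rfl⟩; exact he1 i
      have hle' := Submodule.finrank_mono hle
      have hcard : Fintype.card S +
          (Finset.univ.filter (fun j : Fin N => 0 < (ω * a (e j) (e j)).re)).card = N := by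
        have h1 := Finset.card_filter_add_card_filter_not (s := (Finset.univ : Finset (Fin N)))
          (fun j : Fin N => 0 < (ω * a (e j) (e j)).re)
        rw [Fintype.card_subtype]
        simp only [Finset.card_univ, Fintype.card_fin] at h1
        omega
      omega

end form

section helly

variable {H : Type*} [NormedAddCommGroup H] [InnerProductSpace ℂ H] [FiniteDimensional ℂ H]

lemma inner_span_zero {n : ℕ} (b : OrthonormalBasis (Fin n) ℂ H) (p : Fin n → Prop)
    (x : H) (hx : x ∈ Submodule.span ℂ (Set.range (fun i : {i // p i} => b i))) (j : Fin n)
    (hj : ¬ p j) : inner ℂ (b j) x = 0 := by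
  classical
  obtain ⟨c, rfl⟩ := (Submodule.mem_span_range_iff_exists_fun ℂ).mp hx
  rw [inner_sum]
  refine Finset.sum_eq_zero (fun i _ => ?_)
  rw [inner_smul_right, b.orthonormal.2 (by rintro rfl; exact hj i.2), mul_zero]

lemma spectral_split (n k : ℕ) (hn : Module.finrank ℂ H = n) (hk : 0 < k) (hkn : k ≤ n)
    (T : H →ₗ[ℂ] H) : ∃ (lam : ℝ) (P W : Submodule ℂ H), k ≤ Module.finrank ℂ P ∧
      n ≤ Module.finrank ℂ W + (k - 1) ∧
      (∀ x ∈ P, lam * ‖x‖ ^ 2 ≤ (inner ℂ x (T x)).re) ∧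
      (∀ x ∈ W, (inner ℂ x (T x)).re ≤ lam * ‖x‖ ^ 2) := by
  classical
  have hS : (T + LinearMap.adjoint T).IsSymmetric := by
    intro x y
    simp [inner_add_left, inner_add_right, LinearMap.adjoint_inner_left,
      LinearMap.adjoint_inner_right, add_comm]
  let b := hS.eigenvectorBasis hn
  let ev := hS.eigenvalues hn
  have hanti : Antitone ev := hS.eigenvalues_antitone hn
  have hform : ∀ x : H, 2 * (inner ℂ x (T x)).re = ∑ i, ev i * ‖inner ℂ (b i) x‖ ^ 2 := by
    intro x
    have h1 : 2 * (inner ℂ x (T x)).re = (inner ℂ x ((T + LinearMap.adjoint T) x)).re := by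
      rw [LinearMap.add_apply, inner_add_right, LinearMap.adjoint_inner_right, Complex.add_re,
        ← inner_conj_symm (T x) x, Complex.conj_re]
      ring
    rw [h1, ← b.sum_inner_mul_inner, Complex.re_sum]
    refine Finset.sum_congr rfl (fun i _ => ?_)
    have h2 : inner ℂ (b i) ((T + LinearMap.adjoint T) x) = (ev i : ℂ) * inner ℂ (b i) x := by
      rw [← hS (b i) x, hS.apply_eigenvectorBasis hn i, inner_smul_left]
      simp [ev, b]
    rw [h2, mul_left_comm, Complex.re_ofReal_mul, ← inner_conj_symm x (b i), Complex.conj_mul',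
      ← Complex.ofReal_pow, Complex.ofReal_re]
  have hnorm : ∀ x : H, ‖x‖ ^ 2 = ∑ i, ‖inner ℂ (b i) x‖ ^ 2 := fun x =>
    (b.sum_sq_norm_inner_right x).symm
  let m : Fin n := ⟨k - 1, by omega⟩
  have hfin : ∀ p : Fin n → Prop, Module.finrank ℂ
      (Submodule.span ℂ (Set.range (fun i : {i // p i} => b i))) = Fintype.card {i // p i} :=
    fun p => finrank_span_eq_card (b.orthonormal.linearIndependent.comp _ Subtype.val_injective)
  refine ⟨ev m / 2, Submodule.span ℂ (Set.range (fun i : {i // i ≤ m} => b i)),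
    Submodule.span ℂ (Set.range (fun i : {i // m ≤ i} => b i)), ?_, ?_, ?_, ?_⟩
  · rw [hfin, Fintype.card_subtype]
    have : (Finset.univ.filter (fun i : Fin n => i ≤ m)) = Finset.Iic m := by ext; simp
    rw [this, Fin.card_Iic]
    simp only [m]; omega
  · rw [hfin, Fintype.card_subtype]
    have : (Finset.univ.filter (fun i : Fin n => m ≤ i)) = Finset.Ici m := by ext; simp
    rw [this, Fin.card_Ici]
    simp only [m]; omega
  · intro x hx
    have h1 := hform x
    have h2 : ev m * ‖x‖ ^ 2 ≤ ∑ i, ev i * ‖inner ℂ (b i) x‖ ^ 2 := by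
      rw [hnorm, Finset.mul_sum]
      refine Finset.sum_le_sum (fun i _ => ?_)
      by_cases hi : i ≤ m
      · exact mul_le_mul_of_nonneg_right (hanti hi) (by positivity)
      · rw [inner_span_zero b (fun i => i ≤ m) x hx i hi]; simp
    linarith
  · intro x hx
    have h1 := hform x
    have h2 : ∑ i, ev i * ‖inner ℂ (b i) x‖ ^ 2 ≤ ev m * ‖x‖ ^ 2 := by
      rw [hnorm, Finset.mul_sum]
      refine Finset.sum_le_sum (fun i _ => ?_)
      by_cases hi : m ≤ i
      · exact mul_le_mul_of_nonneg_right (hanti hi) (by positivity)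
      · rw [inner_span_zero b (fun i => m ≤ i) x hx i hi]; simp
    linarith

lemma finrank_iInf {ι : Type*} (W : ι → Submodule ℂ H) (r : ℕ)
    (hW : ∀ i, Module.finrank ℂ H ≤ Module.finrank ℂ (W i) + r) (I : Finset ι) :
    Module.finrank ℂ H ≤ Module.finrank ℂ (⨅ i ∈ I, W i : Submodule ℂ H) + I.card * r := by
  classical
  induction I using Finset.induction_on with
  | empty =>
    have : (⨅ i ∈ (∅ : Finset ι), W i) = ⊤ := by simp
    rw [this, finrank_top]; omega
  | insert i I hi ih =>
    rw [Finset.iInf_insert, Finset.card_insert_of_notMem hi]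
    have h1 := Submodule.finrank_sup_add_finrank_inf_eq (W i) (⨅ j ∈ I, W j)
    have h2 := Submodule.finrank_le (W i ⊔ ⨅ j ∈ I, W j)
    have h3 := hW i
    rw [Nat.succ_mul]
    omega

lemma exists_center (n k : ℕ) (hn : Module.finrank ℂ H = n) (hk : 0 < k)
    (hkn : 3 * (k - 1) < n) (L : H →ₗ[ℂ] H) :
    ∃ μ : ℂ, ∀ ω : ℂ, ∃ P : Submodule ℂ H, k ≤ Module.finrank ℂ P ∧
      ∀ x ∈ P, (ω * μ).re * ‖x‖ ^ 2 ≤ (ω * inner ℂ x (L x)).re := by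
  have hkn' : k ≤ n := by omega
  choose lam P W hP hW hP2 hW2 using fun ω : ℂ => spectral_split n k hn hk hkn' (ω • L)
  let R := ‖LinearMap.toContinuousLinearMap L‖
  let F : ℂ → Set ℂ := fun ω => Metric.closedBall 0 R ∩ {μ | (ω * μ).re ≤ lam ω}
  have hF : (⋂ ω, F ω).Nonempty := by
    refine Convex.helly_theorem_compact' (𝕜 := ℝ) ?_ ?_ ?_
    · intro ω
      refine (convex_closedBall 0 R).inter ?_
      refine convex_halfSpace_le (f := fun μ : ℂ => (ω * μ).re) ?_ _
      constructor
      · intro x y; simp [mul_add]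
      · intro c x; simp; ring
    · intro ω
      refine (isCompact_closedBall 0 R).inter_right ?_
      exact isClosed_le (by fun_prop) continuous_const
    · intro I hI
      rw [Complex.finrank_real_complex] at hI
      have h1 := finrank_iInf W (k - 1) (fun i => by rw [hn]; exact hW i) I
      have h2 : I.card * (k - 1) ≤ 3 * (k - 1) := Nat.mul_le_mul_right _ hI
      have h3 : (⨅ i ∈ I, W i : Submodule ℂ H) ≠ ⊥ := by
        intro h
        rw [h, finrank_bot] at h1
        omega
      obtain ⟨x, hx, hx0⟩ := Submodule.exists_mem_ne_zero_of_ne_bot h3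
      have hxn : ‖x‖ ≠ 0 := norm_ne_zero_iff.mpr hx0
      have hxW : ∀ i ∈ I, x ∈ W i := by simpa [Submodule.mem_iInf] using hx
      have hu : ‖((‖x‖⁻¹ : ℝ) : ℂ) • x‖ = 1 := by
        rw [norm_smul]; simp [hxn]
      generalize hudef : ((‖x‖⁻¹ : ℝ) : ℂ) • x = u at hu
      refine ⟨inner ℂ u (L u), ?_⟩
      rw [Set.mem_iInter₂]
      intro i hi
      refine ⟨?_, ?_⟩
      · rw [mem_closedBall_zero_iff]
        refine (norm_inner_le_norm _ _).trans ?_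
        have := (LinearMap.toContinuousLinearMap L).le_opNorm u
        rw [hu] at this ⊢
        simpa using this
      · have := hW2 i u (hudef ▸ (W i).smul_mem _ (hxW i hi))
        rw [hu] at this
        simpa [inner_smul_right] using this
  obtain ⟨μ, hμ⟩ := hF
  rw [Set.mem_iInter] at hμ
  refine ⟨μ, fun ω => ⟨P ω, hP ω, fun x hx => ?_⟩⟩
  have h1 := hP2 ω x hx
  have h2 : (ω * μ).re ≤ lam ω := (hμ ω).2
  rw [LinearMap.smul_apply, inner_smul_right] at h1
  exact (mul_le_mul_of_nonneg_right h2 (by positivity)).trans h1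

theorem operator_main (n k : ℕ) (hn : Module.finrank ℂ H = n) (hk : 0 < k)
    (hkn : 3 * (k - 1) < n) (L : H →ₗ[ℂ] H) :
    ∃ (μ : ℂ) (u : Fin k → H), Orthonormal ℂ u ∧
      ∀ i j, inner ℂ (u i) (L (u j)) = μ * inner ℂ (u i) (u j) := by
  obtain ⟨μ, hμ⟩ := exists_center n k hn hk hkn L
  let a : H →ₗ⋆[ℂ] H →ₗ[ℂ] ℂ := (innerₛₗ ℂ).compl₂ (L - μ • LinearMap.id)
  have ha : ∀ x y, a x y = inner ℂ x (L y) - μ * inner ℂ x y := by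
    intro x y
    simp [a, inner_sub_right, inner_smul_right]
  have hpos : PosOn a ∅ ⊤ k := by
    intro ω _
    obtain ⟨P, hP, hP2⟩ := hμ ω
    refine ⟨P, le_top, hP, fun x hx => ?_⟩
    have h1 := hP2 x hx
    have h2 : (ω * (μ * inner ℂ x x)).re = (ω * μ).re * ‖x‖ ^ 2 := by
      rw [inner_self_eq_norm_sq_to_K, ← mul_assoc, ← Complex.re_mul_ofReal]
      simp
    rw [ha, mul_sub, Complex.sub_re, h2]
    linarith
  obtain ⟨U, -, hU, hUi⟩ := form_main a _ ⊤ ∅ k rfl (by simp) hpos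
  let b := stdOrthonormalBasis ℂ U
  refine ⟨μ, fun i => (b (Fin.castLE hU i) : H), ?_, ?_⟩
  · have h1 := b.orthonormal.comp (Fin.castLE hU) (Fin.castLE_injective hU)
    exact h1.comp_linearIsometry U.subtypeₗᵢ
  · intro i j
    have := hUi _ (b (Fin.castLE hU i)).2 _ (b (Fin.castLE hU j)).2
    rw [ha, sub_eq_zero] at this
    exact this

end helly
end RankK

/-- If `n, k` are positive integers with `k < n/3 + 1`, then the rank-`k` numerical
range of every `n × n` complex matrix `A` is non-empty: there exist `λ ∈ ℂ` and an
`n × k` matrix `X` with `Xᴴ * X = I_k` and `Xᴴ * A * X = λ • I_k`. -/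
theorem rankKNumericalRange_nonempty (n k : ℕ) (hn : 0 < n) (hk : 0 < k)
    (hkn : (k : ℝ) < (n : ℝ) / 3 + 1) (A : Matrix (Fin n) (Fin n) ℂ) :
    ∃ (lam : ℂ) (X : Matrix (Fin n) (Fin k) ℂ),
      Xᴴ * X = 1 ∧ Xᴴ * A * X = lam • (1 : Matrix (Fin k) (Fin k) ℂ) := by
  have hkn' : 3 * (k - 1) < n := by
    have h1 : (3 * k : ℝ) < n + 3 := by linarith
    have h2 : 3 * k < n + 3 := by exact_mod_cast h1
    omega
  obtain ⟨μ, u, hu, hu2⟩ := RankK.operator_main n k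
    (by simp : Module.finrank ℂ (EuclideanSpace ℂ (Fin n)) = n) hk hkn' (Matrix.toEuclideanLin A)
  have hX : (Matrix.of (fun i j => u j i) : Matrix (Fin n) (Fin k) ℂ)ᴴ *
      Matrix.of (fun i j => u j i) = 1 := by
    ext i j
    have h := (orthonormal_iff_ite.mp hu) i j
    rw [PiLp.inner_apply] at h
    rw [Matrix.mul_apply, Matrix.one_apply, ← h]
    refine Finset.sum_congr rfl (fun l _ => ?_)
    simp [mul_comm]
  refine ⟨μ, Matrix.of (fun i j => u j i), hX, ?_⟩
  rw [← hX]
  ext i j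
  have h := hu2 i j
  rw [PiLp.inner_apply, PiLp.inner_apply] at h
  rw [Matrix.mul_assoc, Matrix.mul_apply, Matrix.smul_apply, Matrix.mul_apply, smul_eq_mul]
  convert h using 1
  · refine Finset.sum_congr rfl (fun l _ => ?_)
    simp [Matrix.mul_apply, Matrix.mulVec, dotProduct, mul_comm]
  · congr 1
    refine Finset.sum_congr rfl (fun l _ => ?_)
    simp [mul_comm]
end

section
/- Let n ≥ 4 be an integer. Then for every complex n×n matrix A, the rank-2 numerical range Λ_2(A) is non-empty; that is, there exist a complex number λ and an n×2 matrix X with X*X = I_2 and X*AX = λ I_2. -/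
open Matrix

section aux
set_option linter.unusedSimpArgs false
set_option linter.unusedSectionVars false
open Module InnerProductSpace ComplexConjugate

variable {V : Type*} [NormedAddCommGroup V] [InnerProductSpace ℂ V] [FiniteDimensional ℂ V]

/-- numerical range of the compression to `S` -/
def numRangeOn (T : V →ₗ[ℂ] V) (S : Submodule ℂ V) : Set ℂ :=
  {z | ∃ x ∈ S, ‖x‖ = 1 ∧ inner ℂ x (T x) = z}

lemma numRangeOn_of_ne {T : V →ₗ[ℂ] V} {S : Submodule ℂ V} {x : V} (hx : x ∈ S) (h0 : x ≠ 0)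
    {z : ℂ} (hz : inner ℂ x (T x) = z * (‖x‖ : ℂ) ^ 2) : z ∈ numRangeOn T S := by
  have hn : (‖x‖ : ℂ) ≠ 0 := by exact_mod_cast norm_ne_zero_iff.2 h0
  refine ⟨((‖x‖ : ℂ)⁻¹) • x, S.smul_mem _ hx, ?_, ?_⟩
  · rw [norm_smul]; simp [h0]
  · rw [map_smul, inner_smul_left, inner_smul_right, hz]
    simp
    field_simp

lemma numRangeOn_compact (T : V →ₗ[ℂ] V) (S : Submodule ℂ V) : IsCompact (numRangeOn T S) := by
  have : FiniteDimensional ℝ V := FiniteDimensional.complexToReal V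
  have : ProperSpace V := FiniteDimensional.proper ℂ V
  have h : numRangeOn T S = (fun x => inner ℂ x (T x)) '' ((S : Set V) ∩ Metric.sphere 0 1) := by
    ext z; simp [numRangeOn, and_assoc]
  rw [h]
  apply IsCompact.image
  · exact (isCompact_sphere (0 : V) 1).inter_left S.closed_of_finiteDimensional
  · have := T.continuous_of_finiteDimensional
    fun_prop

lemma exists_phase (a b : ℂ) : ∃ c : ℂ, ‖c‖ = 1 ∧ (c * a + conj c * b).im = 0 := by
  by_cases h : a - conj b = 0
  · refine ⟨1, by simp, ?_⟩
    have : a = conj b := sub_eq_zero.1 h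
    simp [this]
  · refine ⟨conj (a - conj b) / ‖a - conj b‖, ?_, ?_⟩
    · rw [norm_div, RCLike.norm_conj]; simp [h]
    · set d := a - conj b with hd
      have e : (conj d / (‖d‖ : ℂ) * a + conj (conj d / (‖d‖ : ℂ)) * b)
          = (conj d * a + d * b) / (‖d‖ : ℂ) := by
        simp; ring
      have ha : a = d + conj b := by rw [hd]; ring
      rw [e, Complex.div_ofReal_im, ha]
      simp; left; ring

lemma numRangeOn_convex (T : V →ₗ[ℂ] V) (S : Submodule ℂ V) : Convex ℝ (numRangeOn T S) := by
  rintro _ ⟨x, hxS, hx1, rfl⟩ _ ⟨y, hyS, hy1, rfl⟩ s t hs ht hst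
  set α := inner ℂ x (T x) with hα
  set β := inner ℂ y (T y) with hβ
  by_cases hab : α = β
  · rw [← hab, ← add_smul, hst, one_smul]; exact ⟨x, hxS, hx1, rfl⟩
  have hd : β - α ≠ 0 := sub_ne_zero.2 (Ne.symm hab)
  -- shifted operator
  set B : V →ₗ[ℂ] V := (β - α)⁻¹ • (T - α • LinearMap.id) with hB
  have hTB : ∀ w : V, inner ℂ w (T w) = (β - α) * inner ℂ w (B w) + α * (‖w‖ : ℂ) ^ 2 := by
    intro w
    simp only [hB, LinearMap.smul_apply, LinearMap.sub_apply, LinearMap.id_apply, inner_smul_right,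
      inner_sub_right, inner_self_eq_norm_sq_to_K]
    field_simp
    simp
  have hBx : inner ℂ x (B x) = 0 := by
    have := hTB x
    rw [← hα, hx1] at this
    have h2 : (β - α) * inner ℂ x (B x) = 0 := by linear_combination -this - α * (by simp : ((1:ℝ):ℂ)^2 = 1)
    simpa [hd] using h2
  have hBy : inner ℂ y (B y) = 1 := by
    have := hTB y
    rw [← hβ, hy1] at this
    have h2 : (β - α) * inner ℂ y (B y) = (β - α) * 1 := by
      linear_combination -this - α * (by simp : ((1:ℝ):ℂ)^2 = 1)
    exact mul_left_cancel₀ hd h2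
  obtain ⟨c, hc, him⟩ := exists_phase (inner ℂ y (B x)) (inner ℂ x (B y))
  have hcc : conj c * c = 1 := by
    rw [mul_comm, Complex.mul_conj, Complex.normSq_eq_norm_sq, hc]; simp
  set k := (c * inner ℂ y (B x) + conj c * inner ℂ x (B y)) with hk
  have hkr : k = (k.re : ℂ) := by apply Complex.ext <;> simp [him]
  let w : ℝ → V := fun r => ((1 - r : ℝ) : ℂ) • (c • x) + (r : ℂ) • y
  have hw : ∀ r, inner ℂ (w r) (B (w r)) = ((r ^ 2 + r * (1 - r) * k.re : ℝ) : ℂ) := by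
    intro r
    simp only [w, map_add, map_smul, inner_add_left, inner_add_right, inner_smul_left,
      inner_smul_right, hBx, hBy, Complex.conj_ofReal]
    push_cast
    rw [← hkr, hk]
    ring
  have hw0 : ∀ r, w r ≠ 0 := by
    intro r hr
    have h1 : (r : ℂ) • y = -(((1 - r : ℝ) : ℂ) • (c • x)) := eq_neg_of_add_eq_zero_right hr
    have h2 : inner ℂ ((r : ℂ) • y) (B ((r : ℂ) • y)) = 0 := by
      rw [h1]; simp [inner_smul_left, inner_smul_right, hBx]
    simp [inner_smul_left, inner_smul_right, hBy] at h2
    have h3 : c • x = 0 := by simpa [w, h2] using hr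
    have := congrArg norm h3
    rw [norm_smul, hc, hx1] at this
    simp at this
  have hwS : ∀ r, w r ∈ S := fun r =>
    S.add_mem (S.smul_mem _ (S.smul_mem _ hxS)) (S.smul_mem _ hyS)
  let f : ℝ → ℝ := fun r => (r ^ 2 + r * (1 - r) * k.re) / ‖w r‖ ^ 2
  have hwc : Continuous w := by fun_prop
  have hf : Continuous f := by
    refine Continuous.div (by fun_prop) (by fun_prop) ?_
    intro r; have := norm_ne_zero_iff.2 (hw0 r); positivity
  have hf0 : f 0 = 0 := by simp [f]
  have hf1 : f 1 = 1 := by simp [f, w, hy1]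
  have ht1 : t ∈ Set.Icc (f 0) (f 1) := by rw [hf0, hf1]; constructor <;> linarith
  obtain ⟨r, _, hr⟩ := intermediate_value_Icc (zero_le_one) hf.continuousOn ht1
  apply numRangeOn_of_ne (hwS r) (hw0 r)
  rw [hTB, hw]
  have hn := norm_ne_zero_iff.2 (hw0 r)
  have h5 : r ^ 2 + r * (1 - r) * k.re = t * ‖w r‖ ^ 2 := by
    rw [← hr]; simp only [f]; field_simp
  rw [h5]
  have hs' : s = 1 - t := by linarith
  subst hs'
  simp only [Complex.real_smul]
  push_cast
  ring

lemma finrank_orth_ge (s : Finset V) :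
    finrank ℂ V ≤ finrank ℂ (Submodule.span ℂ (s : Set V))ᗮ + s.card := by
  have h1 := Submodule.finrank_add_finrank_orthogonal (Submodule.span ℂ (s : Set V))
  have h2 := finrank_span_finset_le_card (R := ℂ) s
  unfold Set.finrank at h2
  omega

lemma exists_mu (hV : finrank ℂ V = 4) (T : V →ₗ[ℂ] V) :
    ∃ μ : ℂ, ∀ S : Submodule ℂ V, 3 ≤ finrank ℂ S → μ ∈ numRangeOn T S := by
  classical
  have key : (⋂ S : {S : Submodule ℂ V // 3 ≤ finrank ℂ S}, numRangeOn T S.1).Nonempty := by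
    apply Convex.helly_theorem_compact' (𝕜 := ℝ)
    · intro i; exact numRangeOn_convex T i.1
    · intro i; exact numRangeOn_compact T i.1
    · intro I hI
      rw [Complex.finrank_real_complex] at hI
      have hdim : ∀ J : Finset {S : Submodule ℂ V // 3 ≤ finrank ℂ S},
          4 ≤ finrank ℂ (J.inf (fun S => S.1) : Submodule ℂ V) + J.card := by
        intro J
        induction J using Finset.induction_on with
        | empty => rw [Finset.inf_empty, finrank_top, hV]; omega
        | insert a J ha ih =>
          rw [Finset.inf_insert, Finset.card_insert_of_notMem ha]
          have h1 := Submodule.finrank_sup_add_finrank_inf_eq a.1 (J.inf (fun S => S.1))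
          have h2 := Submodule.finrank_le (a.1 ⊔ (J.inf (fun S => S.1)))
          have h3 := a.2
          omega
      have h1 := hdim I
      have h2 : (I.inf (fun S => S.1) : Submodule ℂ V) ≠ ⊥ := by
        intro h
        rw [h, finrank_bot] at h1
        omega
      obtain ⟨x, hx, hx0⟩ := Submodule.exists_mem_ne_zero_of_ne_bot h2
      have hn : (‖x‖ : ℂ) ≠ 0 := by exact_mod_cast norm_ne_zero_iff.2 hx0
      refine ⟨inner ℂ x (T x) / (‖x‖ : ℂ) ^ 2, ?_⟩
      simp only [Set.mem_iInter]
      intro S hS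
      have hle : (I.inf (fun S => S.1) : Submodule ℂ V) ≤ S.1 := Finset.inf_le hS
      apply numRangeOn_of_ne (hle hx) hx0
      field_simp
  obtain ⟨μ, hμ⟩ := key
  exact ⟨μ, fun S hS => Set.mem_iInter.1 hμ ⟨S, hS⟩⟩

/-- singular real part -/
lemma exists_of_symm (hV : finrank ℂ V = 4) (M : V →ₗ[ℂ] V) (hM : M.IsSymmetric)
    (v : V) (hv : v ≠ 0) (hMv : M v = 0) :
    ∃ S : Submodule ℂ V, 3 ≤ finrank ℂ S ∧ ∀ x ∈ S, inner ℂ x (M x) = 0 → M x = 0 := by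
  set e := hM.eigenvectorBasis hV with he
  set l := hM.eigenvalues hV with hl
  have hanti : Antitone l := hM.eigenvalues_antitone hV
  have happ : ∀ (x : V) (i : Fin 4), inner ℂ (e i) (M x) = (l i : ℂ) * inner ℂ (e i) x := by
    intro x i
    rw [← hM (e i) x, he, hM.apply_eigenvectorBasis, inner_smul_left]
    simp [hl]
  have hzero : ∀ x : V, (∀ i, inner ℂ (e i) x = 0) → x = 0 := by
    intro x hx
    rw [← e.sum_repr' x]
    simp [hx]
  have hquad : ∀ x : V, inner ℂ x (M x) = ((∑ i, l i * ‖inner ℂ (e i) x‖ ^ 2 : ℝ) : ℂ) := by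
    intro x
    rw [← e.sum_inner_mul_inner x (M x)]
    push_cast
    apply Finset.sum_congr rfl
    intro i _
    rw [happ, ← inner_conj_symm x (e i), ← Complex.conj_mul']
    ring
  obtain ⟨i, hi⟩ : ∃ i, l i = 0 := by
    by_contra hcon
    push Not at hcon
    apply hv
    apply hzero
    intro i
    have := happ v i
    rw [hMv, inner_zero_right] at this
    have h0 : (l i : ℂ) ≠ 0 := by exact_mod_cast hcon i
    simpa [h0] using this.symm
  have main : ∀ (j : Fin 4) (σ : ℝ), σ ≠ 0 → (∀ k, k ≠ j → 0 ≤ σ * l k) → 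
      ∃ S : Submodule ℂ V, 3 ≤ finrank ℂ S ∧ ∀ x ∈ S, inner ℂ x (M x) = 0 → M x = 0 := by
    intro j σ hσ hk
    refine ⟨(Submodule.span ℂ (({e j} : Finset V) : Set V))ᗮ, ?_, ?_⟩
    · have := finrank_orth_ge ({e j} : Finset V)
      rw [hV, Finset.card_singleton] at this; omega
    · intro x hx hq
      have hxj : inner ℂ (e j) x = 0 := by
        rw [Submodule.mem_orthogonal] at hx
        exact hx _ (Submodule.subset_span (by simp))
      rw [hquad] at hq
      have hq' : ∑ i, σ * l i * ‖inner ℂ (e i) x‖ ^ 2 = 0 := by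
        have : ∑ i, l i * ‖inner ℂ (e i) x‖ ^ 2 = 0 := by exact_mod_cast hq
        simp_rw [mul_assoc]
        rw [← Finset.mul_sum, this, mul_zero]
      have hnn : ∀ i ∈ Finset.univ, 0 ≤ σ * l i * ‖inner ℂ (e i) x‖ ^ 2 := by
        intro i _
        by_cases hij : i = j
        · subst hij; simp [hxj]
        · exact mul_nonneg (hk i hij) (by positivity)
      rw [Finset.sum_eq_zero_iff_of_nonneg hnn] at hq'
      apply hzero
      intro i
      rw [happ]
      have := hq' i (Finset.mem_univ _)
      simpa [hσ] using this
  by_cases h2 : (2 : Fin 4) ≤ i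
  · apply main 3 1 one_ne_zero
    intro k hk
    have : k ≤ i := by
      have : k.val ≠ 3 := fun h => hk (Fin.ext h)
      have := k.2
      rw [Fin.le_def] at h2 ⊢
      simp at h2
      omega
    have := hanti this
    linarith
  · apply main 0 (-1) (by norm_num)
    intro k hk
    have : i ≤ k := by
      have : k.val ≠ 0 := fun h => hk (Fin.ext h)
      rw [Fin.le_def] at h2 ⊢
      simp at h2
      omega
    have := hanti this
    linarith

lemma exists_v (hV : finrank ℂ V = 4) (T : V →ₗ[ℂ] V)
    (hW : ∀ S : Submodule ℂ V, 3 ≤ finrank ℂ S → ∃ x ∈ S, x ≠ 0 ∧ inner ℂ x (T x) = 0) :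
    ∃ v : V, v ≠ 0 ∧ inner ℂ v (T v) = 0 ∧ ∃ (r : V) (a b : ℂ), T v = a • r ∧
      LinearMap.adjoint T v = b • r := by
  have hnt : Nontrivial V := Module.nontrivial_of_finrank_pos (R := ℂ) (by omega)
  by_cases hT : LinearMap.ker T = ⊥
  · have hbij := LinearEquiv.ofInjectiveEndo T (LinearMap.ker_eq_bot.1 hT)
    let L := LinearEquiv.ofInjectiveEndo T (LinearMap.ker_eq_bot.1 hT)
    obtain ⟨μ, hμ⟩ := Module.End.exists_eigenvalue ((L.symm : V →ₗ[ℂ] V) ∘ₗ LinearMap.adjoint T)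
    obtain ⟨v, hv⟩ := hμ.exists_hasEigenvector
    have h1 := hv.apply_eq_smul
    have h0 := hv.2
    have h2 : LinearMap.adjoint T v = μ • T v := by
      have := congrArg L h1
      simpa [L] using this
    by_cases hq : inner ℂ v (T v) = 0
    · exact ⟨v, h0, hq, T v, 1, μ, by simp, h2⟩
    have hμ1 : μ * conj μ = 1 := by
      have h3 : conj (inner ℂ v (T v)) = μ * inner ℂ v (T v) := by
        rw [inner_conj_symm, ← LinearMap.adjoint_inner_right, h2, inner_smul_right]
      have h4 := congrArg conj h3
      rw [Complex.conj_conj, map_mul, h3] at h4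
      have : (μ * conj μ) * inner ℂ v (T v) = 1 * inner ℂ v (T v) := by
        linear_combination -h4
      exact mul_right_cancel₀ hq this
    obtain ⟨ω, hω⟩ := IsAlgClosed.exists_pow_nat_eq (-μ) (n := 2) (by norm_num)
    have hωn : ω * conj ω = 1 := by
      have h5 : (ω * conj ω) ^ 2 = 1 := by
        rw [mul_pow, ← map_pow, hω, map_neg]; linear_combination hμ1
      rw [Complex.mul_conj] at h5 ⊢
      have h6 : (Complex.normSq ω) ^ 2 = 1 := by exact_mod_cast h5
      have h7 := Complex.normSq_nonneg ω
      have : Complex.normSq ω = 1 := by nlinarith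
      simp [this]
    have hω0 : ω ≠ 0 := by rintro rfl; simp at hωn
    let M : V →ₗ[ℂ] V := ω • T + conj ω • LinearMap.adjoint T
    have hM : M.IsSymmetric := by
      intro x y
      simp only [M, LinearMap.add_apply, LinearMap.smul_apply, inner_add_left, inner_add_right,
        inner_smul_left, inner_smul_right, LinearMap.adjoint_inner_left,
        LinearMap.adjoint_inner_right, Complex.conj_conj]
      ring
    have hMv : M v = 0 := by
      simp only [M, LinearMap.add_apply, LinearMap.smul_apply, h2, smul_smul, ← add_smul]
      have : ω + conj ω * μ = 0 := by
        linear_combination conj ω * hω - ω * hωn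
      rw [this, zero_smul]
    obtain ⟨S, hS, hSM⟩ := exists_of_symm hV M hM v h0 hMv
    obtain ⟨x, hxS, hx0, hxT⟩ := hW S hS
    have hxT' : inner ℂ x (LinearMap.adjoint T x) = 0 := by
      rw [LinearMap.adjoint_inner_right, ← inner_conj_symm, hxT, map_zero]
    have hMx : M x = 0 := hSM x hxS (by simp [M, inner_add_right, inner_smul_right, hxT, hxT'])
    refine ⟨x, hx0, hxT, LinearMap.adjoint T x, -(conj ω * conj ω), 1, ?_, by simp⟩
    have h8 : ω • T x = -(conj ω • LinearMap.adjoint T x) := eq_neg_of_add_eq_zero_left hMx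
    have h9 := congrArg (fun y => conj ω • y) h8
    simp only [smul_smul, smul_neg] at h9
    rw [mul_comm, hωn, one_smul] at h9
    rw [h9, neg_smul]
  · obtain ⟨v, hv, hv0⟩ := Submodule.exists_mem_ne_zero_of_ne_bot hT
    rw [LinearMap.mem_ker] at hv
    exact ⟨v, hv0, by simp [hv], LinearMap.adjoint T v, 0, 1, by simp [hv], by simp⟩

lemma extend_pos (M : V →ₗ[ℂ] V) (hM : M.IsSymmetric) (U : Submodule ℂ V) (v : V)
    (hMv : M v ≠ 0) (hv : inner ℂ v (M v) = 0)
    (hUv : ∀ u ∈ U, inner ℂ u v = 0) (hUM : ∀ u ∈ U, inner ℂ u (M v) = 0)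
    (δ : ℝ) (hδ : 0 < δ) (hpos : ∀ u ∈ U, δ * ‖u‖ ^ 2 ≤ (inner ℂ u (M u)).re) :
    ∃ S : Submodule ℂ V, finrank ℂ U + 1 ≤ finrank ℂ S ∧
      ∀ x ∈ S, x ≠ 0 → 0 < (inner ℂ x (M x)).re := by
  have hv0 : v ≠ 0 := by rintro rfl; simp at hMv
  set z := M v with hz
  set K := ‖M z‖ with hK
  have hz2 : 0 < ‖z‖ ^ 2 := by have := norm_pos_iff.2 hMv; positivity
  obtain ⟨N, hN⟩ := exists_nat_gt (((K ^ 2 / δ + 1) - (inner ℂ z (M z)).re) / (2 * ‖z‖ ^ 2))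
  rw [div_lt_iff₀ (by positivity)] at hN
  set σ : ℝ := (N : ℝ) + 1 with hσ
  have hσ0 : 0 < σ := by positivity
  set y := z + (σ : ℂ) • v with hy
  have hvz : inner ℂ v z = 0 := hv
  have hzv : inner ℂ z v = 0 := by rw [← inner_conj_symm, hvz, map_zero]
  have hvMz : inner ℂ v (M z) = (‖z‖ : ℂ) ^ 2 := by
    rw [← hM v z, ← hz, inner_self_eq_norm_sq_to_K]; rfl
  have hyy : (inner ℂ y (M y)).re = (inner ℂ z (M z)).re + 2 * σ * ‖z‖ ^ 2 := by
    simp only [hy, map_add, map_smul, inner_add_left, inner_add_right, inner_smul_left,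
      inner_smul_right, ← hz, hvz, hvMz, inner_self_eq_norm_sq_to_K, Complex.conj_ofReal]
    have : ((‖z‖ : ℂ)) ^ 2 = ((‖z‖ ^ 2 : ℝ) : ℂ) := by push_cast; rfl
    simp [-Complex.ofReal_pow, ← Complex.ofReal_pow]
    ring
  have hG : K ^ 2 / δ + 1 < (inner ℂ y (M y)).re := by
    rw [hyy, hσ]; nlinarith
  have hyU : y ∉ U := by
    intro h
    have := hUv y h
    rw [hy, inner_add_left, hzv, inner_smul_left] at this
    simp [hv0] at this
    linarith
  refine ⟨U ⊔ Submodule.span ℂ {y}, ?_, ?_⟩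
  · have hlt : U < U ⊔ Submodule.span ℂ {y} := by
      refine lt_of_le_of_ne le_sup_left ?_
      intro h
      apply hyU
      rw [h]
      exact (le_sup_right : Submodule.span ℂ {y} ≤ _) (Submodule.mem_span_singleton_self y)
    exact Submodule.finrank_lt_finrank_of_lt hlt
  · intro x hx hx0
    obtain ⟨u, hu, y', hy', rfl⟩ := Submodule.mem_sup.1 hx
    obtain ⟨c, rfl⟩ := Submodule.mem_span_singleton.1 hy'
    have huy : inner ℂ u (M y) = inner ℂ u (M z) := by
      rw [hy, map_add, map_smul, inner_add_right, inner_smul_right, ← hz, hUM u hu]; simp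
    have hyu : inner ℂ y (M u) = conj (inner ℂ u (M z)) := by
      rw [← hM y u, ← inner_conj_symm, huy]
    have hexp : (inner ℂ (u + c • y) (M (u + c • y))).re =
        (inner ℂ u (M u)).re + 2 * (c * inner ℂ u (M z)).re + ‖c‖ ^ 2 * (inner ℂ y (M y)).re := by
      simp only [map_add, map_smul, inner_add_left, inner_add_right, inner_smul_left,
        inner_smul_right, huy, hyu]
      have e1 : conj c * (c * inner ℂ y (M y)) = ((‖c‖ ^ 2 : ℝ) : ℂ) * inner ℂ y (M y) := by
        rw [← mul_assoc, Complex.conj_mul']; push_cast; rfl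
      have e2 : inner ℂ u (M u) + conj c * conj (inner ℂ u (M z)) +
          c * (inner ℂ u (M z) + conj c * inner ℂ y (M y)) = inner ℂ u (M u) +
          conj (c * inner ℂ u (M z)) + c * inner ℂ u (M z) +
          ((‖c‖ ^ 2 : ℝ) : ℂ) * inner ℂ y (M y) := by
        rw [← e1, map_mul]; ring
      rw [e2]
      simp only [Complex.add_re, Complex.conj_re, Complex.re_ofReal_mul]
      ring
    have hcross : -(‖c‖ * ‖u‖ * K) ≤ (c * inner ℂ u (M z)).re := by
      have h1 := Complex.abs_re_le_norm (c * inner ℂ u (M z))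
      have h2 := norm_inner_le_norm (𝕜 := ℂ) u (M z)
      rw [norm_mul] at h1
      have h3 := mul_le_mul_of_nonneg_left h2 (norm_nonneg c)
      have h4 := neg_abs_le (c * inner ℂ u (M z)).re
      rw [hK]
      linarith [mul_assoc ‖c‖ ‖u‖ ‖M z‖]
    have hp := hpos u hu
    rw [hexp]
    by_cases hc : c = 0
    · subst hc
      have hu0 : u ≠ 0 := by simpa using hx0
      have := norm_pos_iff.2 hu0
      have : 0 < δ * ‖u‖ ^ 2 := by positivity
      simp
      linarith
    · have hcp := norm_pos_iff.2 hc
      have h1 : ‖c‖ ^ 2 * (K ^ 2 / δ + 1) < ‖c‖ ^ 2 * (inner ℂ y (M y)).re := by gcongr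
      have h2 : 0 ≤ (δ * ‖u‖ - ‖c‖ * K) ^ 2 / δ := by positivity
      have h3 : (δ * ‖u‖ - ‖c‖ * K) ^ 2 / δ
          = δ * ‖u‖ ^ 2 - 2 * (‖c‖ * ‖u‖ * K) + ‖c‖ ^ 2 * (K ^ 2 / δ) := by
        field_simp; ring
      have h4 : 0 < ‖c‖ ^ 2 := by positivity
      nlinarith

lemma exists_w (hV : finrank ℂ V = 4) (T : V →ₗ[ℂ] V)
    (hW : ∀ S : Submodule ℂ V, 3 ≤ finrank ℂ S → ∃ x ∈ S, x ≠ 0 ∧ inner ℂ x (T x) = 0)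
    (v : V) (hv0 : v ≠ 0) (hv : inner ℂ v (T v) = 0) (r : V) (a b : ℂ) (ha : T v = a • r)
    (hb : LinearMap.adjoint T v = b • r) :
    ∃ w : V, w ≠ 0 ∧ inner ℂ w v = 0 ∧ inner ℂ w (T w) = 0 ∧ inner ℂ w (T v) = 0 ∧
      inner ℂ w (LinearMap.adjoint T v) = 0 := by
  classical
  by_cases h00 : T v = 0 ∧ LinearMap.adjoint T v = 0
  · obtain ⟨w, hw, hw0, hwT⟩ := hW (Submodule.span ℂ (({v} : Finset V) : Set V))ᗮ (by
      have := finrank_orth_ge ({v} : Finset V)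
      rw [hV, Finset.card_singleton] at this; omega)
    refine ⟨w, hw0, ?_, hwT, by simp [h00.1], by simp [h00.2]⟩
    rw [Submodule.mem_orthogonal'] at hw
    exact hw _ (Submodule.subset_span (by simp))
  set U := (Submodule.span ℂ (({v, r} : Finset V) : Set V))ᗮ with hU
  have hUd : 2 ≤ finrank ℂ U := by
    have := finrank_orth_ge ({v, r} : Finset V)
    have h2 := Finset.card_le_two (a := v) (b := r)
    rw [hV, ← hU] at this; omega
  have hUv : ∀ u ∈ U, inner ℂ u v = 0 := by
    intro u hu
    rw [hU, Submodule.mem_orthogonal'] at hu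
    exact hu _ (Submodule.subset_span (by simp))
  have hUr : ∀ u ∈ U, inner ℂ u r = 0 := by
    intro u hu
    rw [hU, Submodule.mem_orthogonal'] at hu
    exact hu _ (Submodule.subset_span (by simp))
  have hUT : ∀ u ∈ U, inner ℂ u (T v) = 0 := by
    intro u hu; rw [ha, inner_smul_right, hUr u hu, mul_zero]
  have hUT' : ∀ u ∈ U, inner ℂ u (LinearMap.adjoint T v) = 0 := by
    intro u hu; rw [hb, inner_smul_right, hUr u hu, mul_zero]
  by_contra hcon
  have hne : ∀ u ∈ U, u ≠ 0 → inner ℂ u (T u) ≠ 0 := by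
    intro u hu hu0 hq
    exact hcon ⟨u, hu0, hUv u hu, hq, hUT u hu, hUT' u hu⟩
  have h0 : (0 : ℂ) ∉ numRangeOn T U := by
    rintro ⟨x, hx, hx1, hxT⟩
    exact hne x hx (by rintro rfl; simp at hx1) hxT
  obtain ⟨f, δ, hf0, hf⟩ := RCLike.geometric_hahn_banach_point_closed (𝕜 := ℂ) (numRangeOn_convex T U)
    (numRangeOn_compact T U).isClosed h0
  simp at hf0
  set ω := f 1 with hω
  have hfω : ∀ z, f z = ω * z := by
    intro z
    have : z = z • (1 : ℂ) := by simp
    rw [this, map_smul, hω]; simp [mul_comm]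
  obtain ⟨C, hC⟩ := (numRangeOn_compact T U).isBounded.exists_norm_le
  have hvT' : inner ℂ v (LinearMap.adjoint T v) = 0 := by
    rw [LinearMap.adjoint_inner_right, ← inner_conj_symm, hv, map_zero]
  have hsc : ∀ u ∈ U, ∃ z ∈ numRangeOn T U ∪ {0}, inner ℂ u (T u) = ((‖u‖ ^ 2 : ℝ) : ℂ) * z ∧ 
      (u ≠ 0 → z ∈ numRangeOn T U) := by
    intro u hu
    by_cases hu0 : u = 0
    · exact ⟨0, by simp, by simp [hu0], fun h => absurd hu0 h⟩
    · have hn : (‖u‖ : ℂ) ≠ 0 := by exact_mod_cast norm_ne_zero_iff.2 hu0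
      have : inner ℂ u (T u) / (‖u‖ : ℂ) ^ 2 ∈ numRangeOn T U :=
        numRangeOn_of_ne hu hu0 (by field_simp)
      refine ⟨_, Or.inl this, ?_, fun _ => this⟩
      push_cast
      field_simp
  -- the contradiction for a good direction
  have fin : ∀ (η : ℂ) (d : ℝ), 0 < d → (∀ z ∈ numRangeOn T U, d ≤ (η * z).re) →
      η • T v + conj η • LinearMap.adjoint T v ≠ 0 → False := by
    intro η d hd hη hMv
    let M : V →ₗ[ℂ] V := η • T + conj η • LinearMap.adjoint T
    have hM : M.IsSymmetric := by
      intro x y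
      simp only [M, LinearMap.add_apply, LinearMap.smul_apply, inner_add_left, inner_add_right,
        inner_smul_left, inner_smul_right, LinearMap.adjoint_inner_left,
        LinearMap.adjoint_inner_right, Complex.conj_conj]
      ring
    have hMre : ∀ x, (inner ℂ x (M x)).re = 2 * (η * inner ℂ x (T x)).re := by
      intro x
      simp only [M, LinearMap.add_apply, LinearMap.smul_apply, inner_add_right,
        inner_smul_right, LinearMap.adjoint_inner_right]
      rw [← inner_conj_symm (T x) x, ← map_mul, Complex.add_re, Complex.conj_re]; ring
    obtain ⟨S, hS, hSp⟩ := extend_pos M hM U v hMv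
      (by simp [M, inner_add_right, inner_smul_right, hv, hvT']) hUv
      (by intro u hu; simp [M, inner_add_right, inner_smul_right, hUT u hu, hUT' u hu])
      d hd (by
        intro u hu
        rw [hMre]
        by_cases hu0 : u = 0
        · simp [hu0]
        obtain ⟨z, _, hz, hz'⟩ := hsc u hu
        have := hη z (hz' hu0)
        rw [hz, mul_left_comm, Complex.re_ofReal_mul]
        have hn : 0 ≤ ‖u‖ ^ 2 := by positivity
        nlinarith)
    obtain ⟨x, hxS, hx0, hxT⟩ := hW S (by omega)
    have := hSp x hxS hx0
    rw [hMre, hxT] at this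
    simp at this
  have hωd : ∀ z ∈ numRangeOn T U, δ ≤ (ω * z).re := by
    intro z hz
    have := hf z hz
    rw [hfω] at this
    exact this.le
  by_cases hMv : ω • T v + conj ω • LinearMap.adjoint T v = 0
  · -- perturb
    have hω0 : ω ≠ 0 := by
      intro hω0
      have hUne : U ≠ ⊥ := by intro h; rw [h, finrank_bot] at hUd; omega
      obtain ⟨u, hu, hu0⟩ := Submodule.exists_mem_ne_zero_of_ne_bot hUne
      obtain ⟨z, _, hz, hz'⟩ := hsc u hu
      have := hωd z (hz' hu0)
      rw [hω0] at this
      simp at this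
      linarith
    set C' := |C| * ‖ω‖ + 1 with hC'
    have hC'0 : 0 < C' := by positivity
    set ε : ℝ := δ / (2 * C') with hε
    have hε0 : 0 < ε := by positivity
    refine fin (ω + (ε : ℂ) * (Complex.I * ω)) (δ / 2) (by linarith) ?_ ?_
    · intro z hz
      have h1 := hωd z hz
      have h2 : ‖Complex.I * ω * z‖ ≤ C' := by
        rw [norm_mul, norm_mul, Complex.norm_I, one_mul]
        have := (hC z hz).trans (le_abs_self C)
        have h3 := mul_le_mul_of_nonneg_left this (norm_nonneg ω)
        rw [hC']; linarith [mul_comm ‖ω‖ |C|]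
      have h3 := (abs_le.1 (Complex.abs_re_le_norm (Complex.I * ω * z))).1
      have h4 : ((ω + (ε : ℂ) * (Complex.I * ω)) * z).re
          = (ω * z).re + ε * (Complex.I * ω * z).re := by
        rw [← Complex.re_ofReal_mul, ← Complex.add_re]; congr 1; ring
      rw [h4]
      have h5 : ε * C' = δ / 2 := by rw [hε]; field_simp
      nlinarith
    · intro h
      have h1 : (ω + (ε : ℂ) * (Complex.I * ω)) • T v
          + conj (ω + (ε : ℂ) * (Complex.I * ω)) • LinearMap.adjoint T v
          = (ω • T v + conj ω • LinearMap.adjoint T v)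
            - ((ε : ℂ) * Complex.I) • (ω • T v + conj ω • LinearMap.adjoint T v)
            + (2 * (ε : ℂ) * Complex.I * ω) • T v := by
        simp only [map_add, map_mul, Complex.conj_ofReal, Complex.conj_I]
        module
      rw [h1, hMv] at h
      have h2 : T v = 0 := by simpa [hω0, hε0.ne'] using h
      rw [h2] at hMv
      have h3 : LinearMap.adjoint T v = 0 := by simpa [hω0] using hMv
      exact h00 ⟨h2, h3⟩
  · exact fin ω δ hf0 hωd hMv

lemma main4 (hV : finrank ℂ V = 4) (T : V →ₗ[ℂ] V) :
    ∃ (μ : ℂ) (x y : V), ‖x‖ = 1 ∧ ‖y‖ = 1 ∧ inner ℂ x y = 0 ∧ inner ℂ x (T x) = μ ∧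
      inner ℂ y (T y) = μ ∧ inner ℂ x (T y) = 0 ∧ inner ℂ y (T x) = 0 := by
  obtain ⟨μ, hμ⟩ := exists_mu hV T
  set T' : V →ₗ[ℂ] V := T - μ • LinearMap.id with hT'
  have hTT : ∀ x y, inner ℂ x (T y) = inner ℂ x (T' y) + μ * inner ℂ x y := by
    intro x y
    simp [hT', inner_sub_right, inner_smul_right]
  have hW : ∀ S : Submodule ℂ V, 3 ≤ finrank ℂ S → ∃ x ∈ S, x ≠ 0 ∧ inner ℂ x (T' x) = 0 := by
    intro S hS
    obtain ⟨x, hxS, hx1, hx⟩ := hμ S hS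
    refine ⟨x, hxS, by rintro rfl; simp at hx1, ?_⟩
    have := hTT x x
    rw [hx, inner_self_eq_norm_sq_to_K, hx1] at this
    simpa using this
  obtain ⟨v, hv0, hv, r, a, b, ha, hb⟩ := exists_v hV T' hW
  obtain ⟨w, hw0, hwv, hw, hwTv, hwTv'⟩ := exists_w hV T' hW v hv0 hv r a b ha hb
  have hvw : inner ℂ v w = 0 := by rw [← inner_conj_symm, hwv, map_zero]
  have hvTw : inner ℂ v (T' w) = 0 := by
    rw [← LinearMap.adjoint_inner_left, ← inner_conj_symm, hwTv', map_zero]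
  have n1 : ∀ x : V, x ≠ 0 → ‖((‖x‖ : ℂ)⁻¹) • x‖ = 1 := by
    intro x hx; rw [norm_smul]; simp [hx]
  refine ⟨μ, ((‖v‖ : ℂ)⁻¹) • v, ((‖w‖ : ℂ)⁻¹) • w, n1 v hv0, n1 w hw0, ?_, ?_, ?_, ?_, ?_⟩
  · simp [inner_smul_left, inner_smul_right, hvw]
  · rw [hTT, inner_self_eq_norm_sq_to_K, n1 v hv0]
    simp [inner_smul_left, inner_smul_right, hv]
  · rw [hTT, inner_self_eq_norm_sq_to_K, n1 w hw0]
    simp [inner_smul_left, inner_smul_right, hw]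
  · rw [hTT]; simp [inner_smul_left, inner_smul_right, hvw, hvTw]
  · rw [hTT]; simp [inner_smul_left, inner_smul_right, hwv, hwTv]

lemma main_matrix4 (B : Matrix (Fin 4) (Fin 4) ℂ) :
    ∃ (lam : ℂ) (X : Matrix (Fin 4) (Fin 2) ℂ),
      Xᴴ * X = 1 ∧ Xᴴ * B * X = lam • (1 : Matrix (Fin 2) (Fin 2) ℂ) := by
  obtain ⟨μ, x, y, hx, hy, hxy, hxx, hyy, hxTy, hyTx⟩ :=
    main4 (V := EuclideanSpace ℂ (Fin 4)) (by simp) (Matrix.toEuclideanLin B)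
  let c : Fin 2 → EuclideanSpace ℂ (Fin 4) := ![x, y]
  have hyx : inner ℂ y x = 0 := by rw [← inner_conj_symm, hxy, map_zero]
  have hx' : inner ℂ x x = 1 := by rw [inner_self_eq_norm_sq_to_K, hx]; simp
  have hy' : inner ℂ y y = 1 := by rw [inner_self_eq_norm_sq_to_K, hy]; simp
  have e1 : ∀ i j, ((Matrix.of fun k i => c i k)ᴴ * (Matrix.of fun k i => c i k)) i j
      = inner ℂ (c i) (c j) := by
    intro i j
    simp [Matrix.mul_apply, PiLp.inner_apply, mul_comm]
  have e2 : ∀ i j, ((Matrix.of fun k i => c i k)ᴴ * B * (Matrix.of fun k i => c i k)) i j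
      = inner ℂ (c i) (Matrix.toEuclideanLin B (c j)) := by
    intro i j
    rw [Matrix.mul_assoc]
    simp [Matrix.mul_apply, PiLp.inner_apply, mul_comm, Matrix.toLpLin_apply, Matrix.mulVec, dotProduct]
  refine ⟨μ, Matrix.of fun k i => c i k, ?_, ?_⟩
  · ext i j
    rw [e1]
    fin_cases i <;> fin_cases j <;> simp [c, hx', hy', hxy, hyx, hx, hy]
  · ext i j
    rw [e2]
    fin_cases i <;> fin_cases j <;> simp [c, hxx, hyy, hxTy, hyTx]

end aux

/-- If `n ≥ 4`, then the rank-`2` numerical range of every `n × n` complex matrix `A`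
is non-empty: there exist `λ ∈ ℂ` and an `n × 2` matrix `X` with `Xᴴ * X = I_2` and
`Xᴴ * A * X = λ • I_2`. -/
theorem rank2NumericalRange_nonempty (n : ℕ) (hn : 4 ≤ n) (A : Matrix (Fin n) (Fin n) ℂ) :
    ∃ (lam : ℂ) (X : Matrix (Fin n) (Fin 2) ℂ),
      Xᴴ * X = 1 ∧ Xᴴ * A * X = lam • (1 : Matrix (Fin 2) (Fin 2) ℂ) := by
  let J : Matrix (Fin n) (Fin 4) ℂ := (1 : Matrix (Fin n) (Fin n) ℂ).submatrix id (Fin.castLE hn)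
  have hJ : Jᴴ * J = 1 := by
    ext i j
    simp [J, Matrix.mul_apply, Matrix.one_apply]
  obtain ⟨lam, X, h1, h2⟩ := main_matrix4 (Jᴴ * A * J)
  refine ⟨lam, J * X, ?_, ?_⟩
  · rw [Matrix.conjTranspose_mul, Matrix.mul_assoc, ← Matrix.mul_assoc Jᴴ, hJ, Matrix.one_mul, h1]
  · rw [← h2, Matrix.conjTranspose_mul]
    simp only [Matrix.mul_assoc]
end

section
/- Let n and k be positive integers with k ≥ n/3 + 1. Then there exists a complex n×n matrix A whose rank-k numerical range Λ_k(A) is empty; that is, there is no complex number λ and n×k matrix X with X*X = I_k and X*AX = λ I_k. -/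
open Matrix

open scoped ComplexOrder in
lemma rkn_aux (n k : ℕ) (c : ℕ) (hnk : n + 3 ≤ 3 * k) (a : Fin n → ℂ) (lam : ℂ)
    (X : Matrix (Fin n) (Fin k) ℂ) (h1 : Xᴴ * X = 1)
    (h2 : Xᴴ * Matrix.diagonal a * X = lam • (1 : Matrix (Fin k) (Fin k) ℂ)) :
    ∃ p : Fin n → ℝ, 0 < ∑ i, p i ∧ (∀ i : Fin n, (i : ℕ) % 3 = c → p i = 0) ∧
      lam * ((∑ i, p i : ℝ) : ℂ) = ∑ i, a i * (p i : ℂ) := by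
  let B : Matrix (Fin (k - 1)) (Fin k) ℂ := fun j l =>
    if h : 3 * (j : ℕ) + c < n then X ⟨3 * j + c, h⟩ l else 0
  have hker : LinearMap.ker B.mulVecLin ≠ ⊥ := by
    apply LinearMap.ker_ne_bot_of_finrank_lt
    simp
    omega
  obtain ⟨y, hy, hy0⟩ := (Submodule.ne_bot_iff _).1 hker
  have hBy : B *ᵥ y = 0 := by simpa using hy
  have e1 : star (X *ᵥ y) ⬝ᵥ (X *ᵥ y) = star y ⬝ᵥ y := by
    rw [star_mulVec, ← dotProduct_mulVec, mulVec_mulVec, h1, one_mulVec]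
  have e2 : star (X *ᵥ y) ⬝ᵥ (Matrix.diagonal a *ᵥ (X *ᵥ y)) = lam * (star y ⬝ᵥ y) := by
    rw [star_mulVec, ← dotProduct_mulVec, mulVec_mulVec, mulVec_mulVec, h2,
      smul_mulVec, one_mulVec, dotProduct_smul, smul_eq_mul]
  have key : ((∑ i, Complex.normSq ((X *ᵥ y) i) : ℝ) : ℂ) = star y ⬝ᵥ y := by
    rw [← e1]
    simp [dotProduct, Complex.normSq_eq_conj_mul_self]
  refine ⟨fun i => Complex.normSq ((X *ᵥ y) i), ?_, ?_, ?_⟩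
  · refine lt_of_le_of_ne (Finset.sum_nonneg fun i _ => Complex.normSq_nonneg _) ?_
    intro h
    rw [← h] at key
    exact hy0 (dotProduct_star_self_eq_zero.1 (by rw [← key]; simp))
  · intro i hi
    have hj : (i : ℕ) / 3 < k - 1 := by omega
    have := congrFun hBy ⟨(i : ℕ) / 3, hj⟩
    have hi' : 3 * ((i : ℕ) / 3) + c = i := by omega
    have : (X *ᵥ y) i = 0 := by
      simpa [B, mulVec, dotProduct, hi'] using this
    simp [this]
  · rw [key, ← e2]
    simp only [dotProduct, mulVec_diagonal, Complex.normSq_eq_conj_mul_self, Pi.star_apply]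
    refine Finset.sum_congr rfl fun i _ => ?_
    simp only [RCLike.star_def]
    ring

/-- If `n, k` are positive integers with `k ≥ n/3 + 1`, then there exists an `n × n`
complex matrix `A` whose rank-`k` numerical range is empty: no `λ ∈ ℂ` and `n × k`
matrix `X` satisfy `Xᴴ * X = I_k` and `Xᴴ * A * X = λ • I_k`. -/
theorem exists_rankKNumericalRange_empty (n k : ℕ) (hn : 0 < n) (hk : 0 < k)
    (hkn : (n : ℝ) / 3 + 1 ≤ (k : ℝ)) :
    ∃ A : Matrix (Fin n) (Fin n) ℂ,
      ¬ ∃ (lam : ℂ) (X : Matrix (Fin n) (Fin k) ℂ),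
          Xᴴ * X = 1 ∧ Xᴴ * A * X = lam • (1 : Matrix (Fin k) (Fin k) ℂ) := by
  have hnk : n + 3 ≤ 3 * k := by
    have : (n : ℝ) + 3 ≤ 3 * k := by linarith
    exact_mod_cast this
  let a : Fin n → ℂ := fun i =>
    if (i : ℕ) % 3 = 0 then 0 else if (i : ℕ) % 3 = 1 then 1 else Complex.I
  refine ⟨Matrix.diagonal a, ?_⟩
  rintro ⟨lam, X, h1, h2⟩
  have hre : lam.re = 0 := by
    obtain ⟨p, hp, hz, he⟩ := rkn_aux n k 1 hnk a lam X h1 h2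
    have h := congrArg Complex.re he
    rw [Complex.re_mul_ofReal, Complex.re_sum, Finset.sum_eq_zero (f := fun i => (a i * (p i : ℂ)).re)] at h
    · exact (mul_eq_zero.1 h).resolve_right hp.ne'
    · intro i _
      have := hz i
      simp only [a]
      split_ifs with h0 h1 <;> simp_all
  have him : lam.im = 0 := by
    obtain ⟨p, hp, hz, he⟩ := rkn_aux n k 2 hnk a lam X h1 h2
    have h := congrArg Complex.im he
    rw [Complex.im_mul_ofReal, Complex.im_sum, Finset.sum_eq_zero (f := fun i => (a i * (p i : ℂ)).im)] at h
    · exact (mul_eq_zero.1 h).resolve_right hp.ne'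
    · intro i _
      have := hz i
      simp only [a]
      split_ifs with h0 h1
      · simp
      · simp
      · have := hz i (by omega)
        simp [this]
  obtain ⟨p, hp, hz, he⟩ := rkn_aux n k 0 hnk a lam X h1 h2
  have hl : lam = 0 := Complex.ext hre him
  rw [hl, zero_mul] at he
  have hr := congrArg Complex.re he
  have hi := congrArg Complex.im he
  rw [Complex.re_sum] at hr
  rw [Complex.im_sum] at hi
  have : ∑ i, p i = ∑ i, (a i * (p i : ℂ)).re + ∑ i, (a i * (p i : ℂ)).im := by
    rw [← Finset.sum_add_distrib]
    refine Finset.sum_congr rfl fun i _ => ?_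
    have := hz i
    simp only [a]
    split_ifs with h0 h1 <;> simp_all
  rw [← hr, ← hi] at this
  simp at this
  linarith
end

section
/- Let H be an infinite-dimensional complex Hilbert space, let A be a bounded linear operator on H, and let k be a positive integer. Then the rank-k numerical range Λ_k(A) is non-empty; that is, there exist a complex number γ and a linear isometry X : ℂ^k → H such that X*AX = γ I_k, where X* denotes the adjoint of X. -/
open ContinuousLinearMap

/-- Greedy sequence: orthonormal, with `A` diagonal on it. -/
theorem rk_base (H : Type*) [NormedAddCommGroup H] [InnerProductSpace ℂ H] [CompleteSpace H]
    (hH : ¬ FiniteDimensional ℂ H) (A : H →L[ℂ] H) :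
    ∃ e : ℕ → H, (∀ n, ‖e n‖ = 1) ∧ ∀ m n, m ≠ n →
      inner ℂ (e m) (e n) = 0 ∧ inner ℂ (e m) (A (e n)) = 0 := by
  classical
  obtain ⟨f, hf1, hf2⟩ := exists_seq_of_forall_finset_exists (fun x : H => ‖x‖ = 1)
    (fun x y => inner ℂ x y = 0 ∧ inner ℂ (A x) y = 0 ∧
      inner ℂ (ContinuousLinearMap.adjoint A x) y = 0) (by
    intro s _
    let t : Finset H := s ∪ s.image A ∪ s.image (ContinuousLinearMap.adjoint A)
    let W : Submodule ℂ H := Submodule.span ℂ (t : Set H)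
    have hW : FiniteDimensional ℂ W := FiniteDimensional.span_finset ℂ t
    have hne : Wᗮ ≠ ⊥ := by
      intro h
      rw [Submodule.orthogonal_eq_bot_iff] at h
      apply hH
      rw [h] at hW
      exact Module.Finite.equiv (Submodule.topEquiv (R := ℂ) (M := H))
    obtain ⟨y, hy, hy0⟩ := Submodule.exists_mem_ne_zero_of_ne_bot hne
    have hn : ‖y‖ ≠ 0 := norm_ne_zero_iff.mpr hy0
    have key : ∀ x ∈ t, inner ℂ x (((‖y‖⁻¹ : ℝ) : ℂ) • y) = 0 := by
      intro x hx
      rw [inner_smul_right, (Submodule.mem_orthogonal W y).1 hy x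
        (Submodule.subset_span hx), mul_zero]
    refine ⟨((‖y‖⁻¹ : ℝ) : ℂ) • y, ?_, ?_⟩
    · rw [norm_smul]
      simp [hn]
    · intro x hx
      refine ⟨key _ ?_, key _ ?_, key _ ?_⟩
      · simp [t, hx]
      · simp only [t, Finset.mem_union, Finset.mem_image]
        exact Or.inl (Or.inr ⟨x, hx, rfl⟩)
      · simp only [t, Finset.mem_union, Finset.mem_image]
        exact Or.inr ⟨x, hx, rfl⟩)
  refine ⟨f, hf1, fun m n hmn => ?_⟩
  rcases lt_or_gt_of_ne hmn with h | h
  · obtain ⟨h1, h2, h3⟩ := hf2 m n h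
    refine ⟨h1, ?_⟩
    rwa [ContinuousLinearMap.adjoint_inner_left] at h3
  · obtain ⟨h1, h2, h3⟩ := hf2 n m h
    exact ⟨inner_eq_zero_symm.1 h1, inner_eq_zero_symm.1 h2⟩

/-- Radon's theorem for four points of the plane, with square-root weights. -/
theorem rk_radon (z : Fin 4 → ℂ) : ∃ (s : Fin 2 → Fin 4 → ℝ) (γ : ℂ),
    (∀ b b', b ≠ b' → ∀ c, s b c * s b' c = 0) ∧
    (∀ b, ∑ c, ((s b c : ℂ) * s b c) = 1) ∧
    ∀ b, ∑ c, ((s b c : ℂ) * s b c) * z c = γ := by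
  let L : (Fin 4 → ℝ) →ₗ[ℝ] ℂ × ℝ :=
    (Fintype.linearCombination ℝ z).prod (Fintype.linearCombination ℝ (fun _ => (1 : ℝ)))
  have hL : LinearMap.ker L ≠ ⊥ := LinearMap.ker_ne_bot_of_finrank_lt (by
    simp [Module.finrank_prod, Complex.finrank_real_complex])
  obtain ⟨w, hw, hw0⟩ := Submodule.exists_mem_ne_zero_of_ne_bot hL
  have hw' := LinearMap.mem_ker.1 hw
  simp only [L, LinearMap.prod_apply, Function.prod_apply, Prod.mk_eq_zero,
    Fintype.linearCombination_apply, smul_eq_mul, mul_one] at hw'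
  obtain ⟨hz, h1⟩ := hw'
  have hpm : ∀ c, w c = max (w c) 0 - max (- w c) 0 := by
    intro c
    rcases le_total (w c) 0 with h | h
    · rw [max_eq_right h, max_eq_left (by linarith)]; ring
    · rw [max_eq_left h, max_eq_right (by linarith)]; ring
  let p : Fin 2 → Fin 4 → ℝ := ![fun c => max (w c) 0, fun c => max (- w c) 0]
  have hp0 : ∀ b c, 0 ≤ p b c := by
    intro b c
    fin_cases b <;> simp [p]
  set S : ℝ := ∑ c, p 0 c with hS
  have hS1 : ∑ c, p 1 c = S := by
    have : ∑ c, (p 0 c - p 1 c) = 0 := by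
      rw [← h1]; exact Finset.sum_congr rfl fun c _ => (hpm c).symm
    rw [Finset.sum_sub_distrib] at this
    linarith
  have hSb : ∀ b, ∑ c, p b c = S := by
    intro b
    fin_cases b
    · rfl
    · exact hS1
  have hSpos : 0 < S := by
    have hnn : ∀ b, ∀ c, p b c ≤ S := fun b c => by
      rw [← hSb b]; exact Finset.single_le_sum (fun i _ => hp0 b i) (Finset.mem_univ c)
    by_contra hcon
    apply hw0
    funext c
    have a0 := hnn 0 c
    have a1 := hnn 1 c
    have b0 := hp0 0 c
    have b1 := hp0 1 c
    have : w c = p 0 c - p 1 c := hpm c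
    simp only [Pi.zero_apply]
    linarith
  have hzz : ∑ c, (p 0 c : ℂ) * z c = ∑ c, (p 1 c : ℂ) * z c := by
    rw [← sub_eq_zero, ← Finset.sum_sub_distrib, ← hz]
    refine Finset.sum_congr rfl fun c _ => ?_
    have : w c = p 0 c - p 1 c := hpm c
    rw [this, Complex.real_smul]; push_cast; ring
  have hsq : ∀ b c, ((Real.sqrt (p b c / S) : ℝ) : ℂ) * ((Real.sqrt (p b c / S) : ℝ) : ℂ)
      = (p b c : ℂ) * (S : ℂ)⁻¹ := by
    intro b c
    rw [← Complex.ofReal_mul, Real.mul_self_sqrt (div_nonneg (hp0 b c) hSpos.le)]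
    push_cast; rw [div_eq_mul_inv]
  have hSC : (S : ℂ) ≠ 0 := by exact_mod_cast hSpos.ne'
  refine ⟨fun b c => Real.sqrt (p b c / S), (S : ℂ)⁻¹ * ∑ c, (p 0 c : ℂ) * z c, ?_, ?_, ?_⟩
  · intro b b' hb c
    have hpp : p 0 c = 0 ∨ p 1 c = 0 := by
      rcases le_total (w c) 0 with h | h
      · left; exact max_eq_right h
      · right; exact max_eq_right (by linarith)
    have : p b c = 0 ∨ p b' c = 0 := by
      fin_cases b <;> fin_cases b' <;> first | exact absurd rfl hb | exact hpp | exact hpp.symm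
    rcases this with h | h <;> simp [h]
  · intro b
    simp only [hsq]
    rw [← Finset.sum_mul, ← Complex.ofReal_sum, hSb, mul_inv_cancel₀ hSC]
  · intro b
    simp only [hsq]
    have : ∑ c, (p b c : ℂ) * z c = ∑ c, (p 0 c : ℂ) * z c := by
      fin_cases b
      · rfl
      · exact hzz.symm
    rw [← this, Finset.mul_sum]
    exact Finset.sum_congr rfl fun c _ => by ring

/-- A sequence of mutually orthogonal scalar blocks of `A`, indexed by `ι`. -/
def RkBlocks {H : Type*} [NormedAddCommGroup H] [InnerProductSpace ℂ H]
    (A : H →L[ℂ] H) (ι : Type) : Prop :=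
  ∃ (e : ℕ → ι → H) (a : ℕ → ℂ),
    (∀ n i, inner ℂ (e n i) (e n i) = 1) ∧ (∀ n i, inner ℂ (e n i) (A (e n i)) = a n) ∧
    ∀ n i m j, (n, i) ≠ (m, j) →
      inner ℂ (e n i) (e m j) = 0 ∧ inner ℂ (e n i) (A (e m j)) = 0

theorem rk_comb {H : Type*} [NormedAddCommGroup H] [InnerProductSpace ℂ H]
    (T : H →L[ℂ] H) (x y : Fin 4 → H) (s t : Fin 4 → ℝ) :
    inner ℂ (∑ c, (s c : ℂ) • x c) (T (∑ d, (t d : ℂ) • y d)) =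
      ∑ c, ∑ d, (s c : ℂ) * t d * inner ℂ (x c) (T (y d)) := by
  simp only [map_sum, map_smul, sum_inner, inner_sum, inner_smul_left, inner_smul_right,
    Complex.conj_ofReal, Finset.mul_sum]
  rw [Finset.sum_comm]
  exact Finset.sum_congr rfl fun c _ => Finset.sum_congr rfl fun d _ => by ring

theorem rk_step {H : Type*} [NormedAddCommGroup H] [InnerProductSpace ℂ H]
    (A : H →L[ℂ] H) (ι : Type) (h : RkBlocks A ι) : RkBlocks A (ι × Fin 2) := by
  obtain ⟨e, a, h1, hA, h0⟩ := h
  choose s γ hs hs1 hsγ using fun n : ℕ => rk_radon (fun c : Fin 4 => a (4 * n + c))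
  have hinj : ∀ (n m : ℕ) (c d : Fin 4), 4 * n + (c : ℕ) = 4 * m + d → n = m ∧ c = d := by
    intro n m c d hh
    have := c.2
    have := d.2
    exact ⟨by omega, Fin.ext (by omega)⟩
  have diag : ∀ (T : H →L[ℂ] H) (τ : ℕ → ℂ), (∀ n i, inner ℂ (e n i) (T (e n i)) = τ n) →
      (∀ n i m j, (n, i) ≠ (m, j) → inner ℂ (e n i) (T (e m j)) = 0) →
      (∀ n i b, inner ℂ (∑ c, (s n b c : ℂ) • e (4 * n + c) i)
        (T (∑ c, (s n b c : ℂ) • e (4 * n + c) i)) =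
          ∑ c : Fin 4, (s n b c : ℂ) * s n b c * τ (4 * n + c)) ∧
      (∀ n i b m j b', (n, (i, b)) ≠ (m, (j, b')) →
        inner ℂ (∑ c, (s n b c : ℂ) • e (4 * n + c) i)
        (T (∑ c, (s m b' c : ℂ) • e (4 * m + c) j)) = 0) := by
    intro T τ hτ hτ0
    refine ⟨fun n i b => ?_, fun n i b m j b' hne => ?_⟩
    · rw [rk_comb T (fun c => e (4 * n + c) i) (fun c => e (4 * n + c) i)]
      refine Finset.sum_congr rfl fun c _ => ?_
      rw [Finset.sum_eq_single c]
      · rw [hτ]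
      · intro d _ hd
        rw [hτ0, mul_zero]
        intro hh
        exact hd (hinj _ _ _ _ (Prod.mk.inj hh).1).2.symm
      · simp
    · rw [rk_comb T (fun c => e (4 * n + c) i) (fun c => e (4 * m + c) j)]
      refine Finset.sum_eq_zero fun c _ => Finset.sum_eq_zero fun d _ => ?_
      by_cases hh : (4 * n + (c : ℕ), i) = (4 * m + (d : ℕ), j)
      · obtain ⟨hh1, rfl⟩ := Prod.mk.inj hh
        obtain ⟨rfl, rfl⟩ := hinj _ _ _ _ hh1
        have hb : b ≠ b' := fun hb => hne (by rw [hb])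
        rw [← Complex.ofReal_mul, hs n b b' hb c]
        simp
      · rw [hτ0 _ _ _ _ hh, mul_zero]
  obtain ⟨d1, d2⟩ := diag (ContinuousLinearMap.id ℂ H) (fun _ => 1) h1
    (fun n i m j hh => (h0 n i m j hh).1)
  obtain ⟨d3, d4⟩ := diag A a hA (fun n i m j hh => (h0 n i m j hh).2)
  refine ⟨fun n x => ∑ c, (s n x.2 c : ℂ) • e (4 * n + c) x.1, γ, ?_, ?_, ?_⟩
  · rintro n ⟨i, b⟩
    have := d1 n i b
    simp only [mul_one, hs1] at this
    exact this
  · rintro n ⟨i, b⟩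
    exact (d3 n i b).trans (hsγ n b)
  · rintro n ⟨i, b⟩ m ⟨j, b'⟩ hne
    exact ⟨d2 n i b m j b' hne, d4 n i b m j b' hne⟩

theorem rk_emb {H : Type*} [NormedAddCommGroup H] [InnerProductSpace ℂ H]
    (A : H →L[ℂ] H) (ι κ : Type) (f : κ ↪ ι) (h : RkBlocks A ι) : RkBlocks A κ := by
  obtain ⟨e, a, h1, hA, h0⟩ := h
  refine ⟨fun n i => e n (f i), a, fun n i => h1 n _, fun n i => hA n _, ?_⟩
  intro n i m j hne
  apply h0
  intro hh
  obtain ⟨rfl, hij⟩ := Prod.mk.inj hh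
  exact hne (by rw [f.injective hij])

theorem rk_all (H : Type*) [NormedAddCommGroup H] [InnerProductSpace ℂ H] [CompleteSpace H]
    (hH : ¬ FiniteDimensional ℂ H) (A : H →L[ℂ] H) (m : ℕ) : RkBlocks A (Fin (2 ^ m)) := by
  induction m with
  | zero =>
    obtain ⟨e, h1, h0⟩ := rk_base H hH A
    refine ⟨fun n _ => e n, fun n => inner ℂ (e n) (A (e n)), ?_, fun _ _ => rfl, ?_⟩
    · intro n i
      rw [inner_self_eq_norm_sq_to_K, h1]
      simp
    · intro n i m j hne
      apply h0
      rintro rfl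
      apply hne
      have : i = j := Fin.ext (by have := i.2; have := j.2; simp at *)
      rw [this]
  | succ m ih =>
    exact rk_emb A _ _ (finProdFinEquiv (m := 2 ^ m) (n := 2)).symm.toEmbedding (rk_step A _ ih)

/-- If `H` is an infinite-dimensional complex Hilbert space, `A` a bounded linear
operator on `H`, and `k` a positive integer, then the rank-`k` numerical range of
`A` is non-empty: there exist `γ ∈ ℂ` and an isometric linear map
`X : ℂ^k → H` (i.e. `X* ∘ X = I`) with `X* ∘ A ∘ X = γ • I`. -/
theorem rankKNumericalRange_nonempty_of_infiniteDimensional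
    (H : Type*) [NormedAddCommGroup H] [InnerProductSpace ℂ H] [CompleteSpace H]
    (hH : ¬ FiniteDimensional ℂ H) (A : H →L[ℂ] H) (k : ℕ) (hk : 0 < k) :
    ∃ (γ : ℂ) (X : EuclideanSpace ℂ (Fin k) →L[ℂ] H),
      (ContinuousLinearMap.adjoint X).comp X =
        ContinuousLinearMap.id ℂ (EuclideanSpace ℂ (Fin k)) ∧
      ((ContinuousLinearMap.adjoint X).comp (A.comp X)) =
        γ • ContinuousLinearMap.id ℂ (EuclideanSpace ℂ (Fin k)) := by
  obtain ⟨e, a, h1, hA, h0⟩ := rk_emb A _ (Fin k)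
    (Fin.castLEEmb (Nat.lt_two_pow_self (n := k)).le) (rk_all H hH A k)
  let X : EuclideanSpace ℂ (Fin k) →L[ℂ] H :=
    ∑ i, (EuclideanSpace.proj (𝕜 := ℂ) i : EuclideanSpace ℂ (Fin k) →L[ℂ] ℂ).smulRight (e 0 i)
  have hX : ∀ v, X v = ∑ i, v i • e 0 i := by
    intro v
    simp [X]
  have key : ∀ (T : H →L[ℂ] H) (γ : ℂ), (∀ i, inner ℂ (e 0 i) (T (e 0 i)) = γ) →
      (∀ i j, i ≠ j → inner ℂ (e 0 i) (T (e 0 j)) = 0) →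
      (ContinuousLinearMap.adjoint X).comp (T.comp X) =
        γ • ContinuousLinearMap.id ℂ (EuclideanSpace ℂ (Fin k)) := by
    intro T γ hd ho
    ext1 v
    refine ext_inner_left ℂ fun u => ?_
    simp only [ContinuousLinearMap.comp_apply, ContinuousLinearMap.adjoint_inner_right, hX,
      map_sum, map_smul, sum_inner, inner_sum, inner_smul_left, inner_smul_right,
      ContinuousLinearMap.smul_apply, ContinuousLinearMap.id_apply, PiLp.inner_apply,
      RCLike.inner_apply, Finset.mul_sum]
    refine Finset.sum_congr rfl fun i _ => ?_
    rw [Finset.sum_eq_single i]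
    · rw [hd]; ring
    · intro j _ hj
      rw [ho _ _ hj]; simp
    · simp
  refine ⟨a 0, X, ?_, ?_⟩
  · have := key (ContinuousLinearMap.id ℂ H) 1 (fun i => h1 0 i)
      (fun i j hij => (h0 0 i 0 j (fun hh => hij (Prod.mk.inj hh).2)).1)
    rwa [ContinuousLinearMap.id_comp, one_smul] at this
  · exact key A (a 0) (fun i => hA 0 i)
      (fun i j hij => (h0 0 i 0 j (fun hh => hij (Prod.mk.inj hh).2)).2)
end
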